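/- Let n be an odd prime and let H be a finitely generated subgroup of SL(n,ℤ). If H contains an element whose characteristic polynomial is irreducible over ℚ and H is not solvable-by-finite, then φ_p(H) = SL(n,ℤ/pℤ) for all but finitely many primes p. -/

import Mathlib

open Matrix

/-- `SL n R` : the special linear group of `n × n` matrices over `R`. -/
abbrev SL (n : ℕ) (R : Type*) [CommRing R] := Matrix.SpecialLinearGroup (Fin n) R

/-- The reduction-mod-`p` homomorphism `φ_p : SL(n,ℤ) → SL(n,ℤ/pℤ)`. -/
def redMod (n p : ℕ) : SL n ℤ →* SL n (ZMod p) :=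
  Matrix.SpecialLinearGroup.map (Int.castRingHom (ZMod p))

/-- The rational matrix underlying an element of `SL(n,ℤ)`. -/
def matQ {n : ℕ} (g : SL n ℤ) : Matrix (Fin n) (Fin n) ℚ :=
  (g : Matrix (Fin n) (Fin n) ℤ).map ((↑) : ℤ → ℚ)

/-- A subgroup of `SL(n,ℤ)` is absolutely irreducible over `ℚ` if its elements generate the
full matrix algebra over `ℚ`. -/
def AbsIrredQ {n : ℕ} (H : Subgroup (SL n ℤ)) : Prop :=
  Algebra.adjoin ℚ (matQ '' (H : Set (SL n ℤ))) = ⊤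

/-- A subgroup of `SL(n, ℤ/pℤ)` is absolutely irreducible if its elements generate the
full matrix algebra over `ℤ/pℤ`. -/
def AbsIrredMod {n p : ℕ} (G : Subgroup (SL n (ZMod p))) : Prop :=
  Algebra.adjoin (ZMod p)
    ((fun g : SL n (ZMod p) => (g : Matrix (Fin n) (Fin n) (ZMod p))) '' (G : Set _)) = ⊤

/-- Irreducibility of the natural action of a subgroup of `SL(n,R)` on `R^n`. -/
def IrreducibleSub (R : Type*) [CommRing R] {n : ℕ} (G : Subgroup (SL n R)) : Prop :=
  ∀ W : Submodule R (Fin n → R),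
    (∀ g ∈ G, W.map (Matrix.toLin' (g : Matrix (Fin n) (Fin n) R)) ≤ W) → W = ⊥ ∨ W = ⊤

/-- Imprimitivity: a nontrivial direct-sum decomposition whose summands are permuted by `G`. -/
def ImprimitiveSub (R : Type*) [CommRing R] {n : ℕ} (G : Subgroup (SL n R)) : Prop :=
  ∃ m : ℕ, 2 ≤ m ∧ ∃ W : Fin m → Submodule R (Fin n → R),
    (∀ i, W i ≠ ⊥) ∧ DirectSum.IsInternal W ∧
    ∀ g ∈ G, ∀ i, ∃ j, (W i).map (Matrix.toLin' (g : Matrix (Fin n) (Fin n) R)) = W j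

/-- Primitivity: irreducible and not imprimitive. -/
def PrimitiveSub (R : Type*) [CommRing R] {n : ℕ} (G : Subgroup (SL n R)) : Prop :=
  IrreducibleSub R G ∧ ¬ ImprimitiveSub R G

/-- Monomiality: a direct sum of `n` one-dimensional subspaces permuted by `G`. -/
def MonomialSub (R : Type*) [CommRing R] {n : ℕ} (G : Subgroup (SL n R)) : Prop :=
  ∃ L : Fin n → Submodule R (Fin n → R),
    (∀ i, Module.finrank R (L i) = 1) ∧ DirectSum.IsInternal L ∧
    ∀ g ∈ G, ∀ i, ∃ j, (L i).map (Matrix.toLin' (g : Matrix (Fin n) (Fin n) R)) = L j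

/-- Irreducibility of a subgroup of `SL(n,ℤ)` acting on `ℚ^n`. -/
def IrreducibleQ {n : ℕ} (H : Subgroup (SL n ℤ)) : Prop :=
  ∀ W : Submodule ℚ (Fin n → ℚ),
    (∀ g ∈ H, W.map (Matrix.toLin' (matQ g)) ≤ W) → W = ⊥ ∨ W = ⊤

/-- Imprimitivity of a subgroup of `SL(n,ℤ)` acting on `ℚ^n`. -/
def ImprimitiveQ {n : ℕ} (H : Subgroup (SL n ℤ)) : Prop :=
  ∃ m : ℕ, 2 ≤ m ∧ ∃ W : Fin m → Submodule ℚ (Fin n → ℚ),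
    (∀ i, W i ≠ ⊥) ∧ DirectSum.IsInternal W ∧
    ∀ g ∈ H, ∀ i, ∃ j, (W i).map (Matrix.toLin' (matQ g)) = W j

/-- Primitivity of a subgroup of `SL(n,ℤ)` acting on `ℚ^n`. -/
def PrimitiveQ {n : ℕ} (H : Subgroup (SL n ℤ)) : Prop :=
  IrreducibleQ H ∧ ¬ ImprimitiveQ H

/-- A group is solvable-by-finite if it has a solvable subgroup of finite index. -/
def SolvableByFinite (G : Type*) [Group G] : Prop :=
  ∃ K : Subgroup G, IsSolvable K ∧ K.FiniteIndex

/-- A subgroup of `SL(n,ℤ)` is an isometry group if it preserves a nondegenerate bilinear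
form on `ℚ^n`. -/
def IsometryGroupQ {n : ℕ} (H : Subgroup (SL n ℤ)) : Prop :=
  ∃ Φ : Matrix (Fin n) (Fin n) ℚ, IsUnit Φ ∧ ∀ h ∈ H, matQ h * Φ * (matQ h)ᵀ = Φ

section Jordan

variable {𝔸 : Type*} [NormedRing 𝔸] [NormedAlgebra ℂ 𝔸]

/-- spectral projections of an element of finite order -/
noncomputable def specProj (m : ℕ) (c : ℂ) (x : 𝔸) : 𝔸 :=
  ((m : ℂ)⁻¹) • ∑ l ∈ Finset.range m, (c • x) ^ l

lemma specProj_mul_self {m : ℕ} (hm : m ≠ 0) {c : ℂ} (hc : c ^ m = 1) {x : 𝔸} (hx : x ^ m = 1) :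
    specProj m c x * specProj m c x = specProj m c x := by
  set z := c • x with hz
  have hzm : z ^ m = 1 := by rw [hz, smul_pow, hc, hx, one_smul]
  have h1 : z * specProj m c x = specProj m c x := by
    have := mul_geom_sum z m
    rw [hzm, sub_self, sub_mul, one_mul, sub_eq_zero] at this
    unfold specProj
    rw [mul_smul_comm, this]
  have h2 : ∀ l : ℕ, z ^ l * specProj m c x = specProj m c x := by
    intro l
    induction l with
    | zero => simp
    | succ k ih => rw [pow_succ, mul_assoc, h1, ih]
  have h3 : specProj m c x * specProj m c x
      = ((m : ℂ)⁻¹ • ∑ l ∈ Finset.range m, z ^ l) * specProj m c x := rfl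
  rw [h3, smul_mul_assoc, Finset.sum_mul, Finset.sum_congr rfl (fun l _ => h2 l), Finset.sum_const,
    Finset.card_range, ← Nat.cast_smul_eq_nsmul ℂ, smul_smul, inv_mul_cancel₀, one_smul]
  exact_mod_cast hm

lemma norm_specProj_le {m : ℕ} {c : ℂ} (hc : ‖c‖ = 1) {x : 𝔸}
    (hx : ∀ l, ‖x ^ l‖ ≤ 1) : ‖specProj m c x‖ ≤ 1 := by
  unfold specProj
  rw [norm_smul]
  have : ‖∑ l ∈ Finset.range m, (c • x) ^ l‖ ≤ m := by
    refine (norm_sum_le _ _).trans ?_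
    calc _ ≤ ∑ l ∈ Finset.range m, (1 : ℝ) := by
          refine Finset.sum_le_sum fun l _ => ?_
          rw [smul_pow, norm_smul, norm_pow, hc, one_pow, one_mul]
          exact hx l
      _ = m := by simp
  rw [norm_inv, Complex.norm_natCast]
  rcases Nat.eq_zero_or_pos m with h | h
  · subst h; simp
  · rw [inv_mul_le_iff₀ (by exact_mod_cast h)]; simpa using this

lemma sum_specProj {m : ℕ} (hm : m ≠ 0) {ζ : ℂ} (hζ : IsPrimitiveRoot ζ m) {x : 𝔸}
    (hx : x ^ m = 1) :
    ∑ j ∈ Finset.range m, (ζ ^ j) • specProj m (ζ ^ j) x = x ^ (m - 1) := by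
  have hm' : (m : ℂ) ≠ 0 := by exact_mod_cast hm
  unfold specProj
  simp_rw [Finset.smul_sum, smul_smul, smul_pow, smul_smul]
  rw [Finset.sum_comm]
  simp_rw [← Finset.sum_smul]
  rw [Finset.sum_eq_single (m - 1)]
  · have : ∀ j ∈ Finset.range m, ζ ^ j * (m : ℂ)⁻¹ * (ζ ^ j) ^ (m - 1) = (m : ℂ)⁻¹ := by
      intro j _
      have : ζ ^ j * (ζ ^ j) ^ (m - 1) = 1 := by
        rw [← pow_succ', Nat.sub_add_cancel (Nat.pos_of_ne_zero hm), ← pow_mul, mul_comm, pow_mul,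
          hζ.pow_eq_one, one_pow]
      rw [mul_right_comm, this, one_mul]
    rw [Finset.sum_congr rfl this]
    simp [hm']
  · intro l hl hne
    have hl' := Finset.mem_range.mp hl
    have : ∀ j ∈ Finset.range m, ζ ^ j * (m : ℂ)⁻¹ * (ζ ^ j) ^ l = (m : ℂ)⁻¹ * (ζ ^ (l + 1)) ^ j := by
      intro j _
      rw [← pow_mul, ← pow_mul, mul_right_comm, ← pow_add, mul_comm]; congr 2; ring
    rw [Finset.sum_congr rfl this, ← Finset.mul_sum]
    have hne1 : ζ ^ (l + 1) ≠ 1 := by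
      rw [Ne, hζ.pow_eq_one_iff_dvd]
      intro hd
      have := Nat.le_of_dvd (Nat.succ_pos l) hd
      omega
    have : ∑ j ∈ Finset.range m, (ζ ^ (l + 1)) ^ j = 0 := by
      have h := mul_geom_sum (ζ ^ (l + 1)) m
      rw [← pow_mul, mul_comm (l + 1), pow_mul, hζ.pow_eq_one, one_pow, sub_self] at h
      exact (mul_eq_zero.mp h).resolve_left (sub_ne_zero.mpr hne1)
    rw [this, mul_zero, zero_smul]
  · intro h
    exact absurd (Finset.mem_range.mpr (by omega)) h

variable {G : Type*} [Group G] [Finite G] (ρ : G →* 𝔸)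

lemma jordan_comm_step (hρ : Function.Injective ρ) (hn : ∀ g, ‖ρ g‖ ≤ 1) (a b : G)
    (hb : ‖ρ b - 1‖ < 1 / 2) (hab : Commute a (b * a * b⁻¹)) : Commute a b := by
  set m := orderOf a with hmdef
  have hm : m ≠ 0 := (orderOf_pos a).ne'
  have hxm : ρ a ^ m = 1 := by rw [← map_pow, pow_orderOf_eq_one, map_one]
  set y := ρ (b * a * b⁻¹) with hy
  have hbb : ρ b * ρ b⁻¹ = 1 := by rw [← map_mul]; simp
  have hbb' : ρ b⁻¹ * ρ b = 1 := by rw [← map_mul]; simp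
  have hyl : ∀ l : ℕ, y ^ l = ρ b * ρ a ^ l * ρ b⁻¹ := by
    intro l
    rw [hy, ← map_pow, conj_pow, map_mul, map_mul, map_pow]
  have hym : y ^ m = 1 := by rw [hyl, hxm, mul_one, hbb]
  have hP : ∀ c : ℂ, specProj m c y = ρ b * specProj m c (ρ a) * ρ b⁻¹ := by
    intro c
    unfold specProj
    rw [mul_smul_comm, smul_mul_assoc, Finset.mul_sum, Finset.sum_mul]
    congr 1
    refine Finset.sum_congr rfl fun l _ => ?_
    rw [smul_pow, smul_pow, hyl, mul_smul_comm, smul_mul_assoc]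
  have hcomm : Commute (ρ a) y := by
    have := hab.map ρ
    exact this
  have key : ∀ c : ℂ, c ^ m = 1 → specProj m c (ρ a) = specProj m c y := by
    intro c hc
    have hc1 : ‖c‖ = 1 := Complex.norm_eq_one_of_pow_eq_one hc hm
    set P := specProj m c (ρ a) with hPd
    set Q := specProj m c y with hQd
    have hPP : P * P = P := specProj_mul_self hm hc hxm
    have hQQ : Q * Q = Q := specProj_mul_self hm hc hym
    have hPQ : Commute P Q := by
      rw [hPd, hQd]
      unfold specProj
      refine Commute.smul_left (Commute.smul_right ?_ _) _
      refine Commute.sum_left _ _ _ fun i _ => Commute.sum_right _ _ _ fun j _ => ?_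
      exact Commute.pow_pow ((hcomm.smul_left _).smul_right _) _ _
    have hPn : ‖P‖ ≤ 1 := norm_specProj_le hc1 (fun l => by rw [← map_pow]; exact hn _)
    have hE : (P - Q) * (P - Q) * (P - Q) = P - Q := by
      have e1 : (P - Q) * (P - Q) = P + Q - P * Q - P * Q := by
        rw [mul_sub, sub_mul, sub_mul, hPP, hQQ, ← hPQ.eq]; abel
      rw [e1]
      have a1 : P * Q * P = P * Q := by rw [mul_assoc, ← hPQ.eq, ← mul_assoc, hPP]
      have a2 : P * Q * Q = P * Q := by rw [mul_assoc, hQQ]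
      simp only [mul_sub, sub_mul, add_mul, hPP, hQQ, a1, a2, ← hPQ.eq]
      abel
    have hlt : ‖P - Q‖ < 1 := by
      have : P - Q = (P * (ρ b - 1) - (ρ b - 1) * P) * ρ b⁻¹ := by
        rw [hQd, hP c, ← hPd]
        have : (P * (ρ b - 1) - (ρ b - 1) * P) = P * ρ b - ρ b * P := by
          simp only [mul_sub, sub_mul, mul_one, one_mul]; abel
        rw [this, sub_mul, mul_assoc P, hbb, mul_one]
      rw [this]
      have h1 : ‖P * (ρ b - 1) - (ρ b - 1) * P‖ ≤ ‖ρ b - 1‖ + ‖ρ b - 1‖ := by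
        refine (norm_sub_le _ _).trans (add_le_add ?_ ?_)
        · refine (norm_mul_le _ _).trans ?_
          exact mul_le_of_le_one_left (norm_nonneg _) hPn
        · refine (norm_mul_le _ _).trans ?_
          exact mul_le_of_le_one_right (norm_nonneg _) hPn
      calc _ ≤ ‖P * (ρ b - 1) - (ρ b - 1) * P‖ * ‖ρ b⁻¹‖ := norm_mul_le _ _
        _ ≤ ‖P * (ρ b - 1) - (ρ b - 1) * P‖ := mul_le_of_le_one_right (norm_nonneg _) (hn _)
        _ < 1 := by linarith
    have hle : ‖P - Q‖ ≤ ‖P - Q‖ * ‖P - Q‖ * ‖P - Q‖ := by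
      conv_lhs => rw [← hE]
      exact (norm_mul_le _ _).trans (by gcongr; exact norm_mul_le _ _)
    have h0 : ‖P - Q‖ = 0 := by
      by_contra hne
      have hpos : 0 < ‖P - Q‖ := lt_of_le_of_ne (norm_nonneg _) (Ne.symm hne)
      nlinarith [mul_lt_mul_of_pos_left hlt hpos, mul_pos hpos hpos]
    rwa [norm_eq_zero, sub_eq_zero] at h0
  obtain ⟨ζ, hζ⟩ : ∃ ζ : ℂ, IsPrimitiveRoot ζ m := ⟨_, Complex.isPrimitiveRoot_exp m hm⟩
  have e1 := sum_specProj hm hζ hxm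
  have e2 := sum_specProj hm hζ hym
  have e3 : ρ a ^ (m - 1) = y ^ (m - 1) := by
    rw [← e1, ← e2]
    refine Finset.sum_congr rfl fun j _ => ?_
    rw [key]
    rw [← pow_mul, mul_comm, pow_mul, hζ.pow_eq_one, one_pow]
  have e4 : ρ a = y := by
    have s : m - 1 + 1 = m := Nat.sub_add_cancel (Nat.pos_of_ne_zero hm)
    have hu : ρ a * y ^ (m - 1) = 1 := by rw [← e3, ← pow_succ', s, hxm]
    have hv : y ^ (m - 1) * y = 1 := by rw [← pow_succ, s, hym]
    exact left_inv_eq_right_inv hu hv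
  have e5 := hρ e4
  rw [eq_mul_inv_iff_mul_eq] at e5
  exact e5

lemma jordan_small_comm (hρ : Function.Injective ρ) (hn : ∀ g, ‖ρ g‖ ≤ 1) (a b : G)
    (ha : ‖ρ a - 1‖ < 1 / 2) (hb : ‖ρ b - 1‖ < 1 / 2) : Commute a b := by
  have step : ∀ b : G, ‖ρ (a * b * a⁻¹ * b⁻¹) - 1‖ ≤ (2 * ‖ρ a - 1‖) * ‖ρ b - 1‖ := by
    intro b
    have e : ρ (a * b * a⁻¹ * b⁻¹) - 1 = ((ρ a - 1) * (ρ b - 1) - (ρ b - 1) * (ρ a - 1)) * (ρ (a⁻¹ * b⁻¹)) := by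
      have h1 : (ρ a - 1) * (ρ b - 1) - (ρ b - 1) * (ρ a - 1) = ρ (a * b) - ρ (b * a) := by
        simp only [mul_sub, sub_mul, mul_one, one_mul, map_mul]; abel
      rw [h1, sub_mul, ← map_mul, ← map_mul]
      congr 2
      · group
      · rw [← map_one ρ]; congr 1; group
    rw [e]
    refine (norm_mul_le _ _).trans ((mul_le_of_le_one_right (norm_nonneg _) (hn _)).trans ?_)
    refine (norm_sub_le _ _).trans ?_
    have := norm_mul_le (ρ a - 1) (ρ b - 1)
    have := norm_mul_le (ρ b - 1) (ρ a - 1)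
    linarith
  set r := 2 * ‖ρ a - 1‖ with hr
  have hr0 : 0 ≤ r := by positivity
  have hr1 : r < 1 := by rw [hr]; linarith
  let B : ℕ → G := fun i => Nat.rec b (fun _ x => a * x * a⁻¹ * x⁻¹) i
  have hB : ∀ i, B (i + 1) = a * B i * a⁻¹ * (B i)⁻¹ := fun i => rfl
  have hBn : ∀ i, ‖ρ (B i) - 1‖ ≤ r ^ i * ‖ρ b - 1‖ := by
    intro i
    induction i with
    | zero => simp [B]
    | succ k ih =>
      rw [hB]
      calc _ ≤ r * ‖ρ (B k) - 1‖ := step _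
        _ ≤ r * (r ^ k * ‖ρ b - 1‖) := by gcongr
        _ = _ := by ring
  have hBs : ∀ i, ‖ρ (B i) - 1‖ < 1 / 2 := by
    intro i
    refine (hBn i).trans_lt (lt_of_le_of_lt ?_ hb)
    exact mul_le_of_le_one_left (norm_nonneg _) (pow_le_one₀ hr0 hr1.le)
  -- eventually trivial
  have hfin : ∃ N, B N = 1 := by
    have htend : Filter.Tendsto (fun i => r ^ i * ‖ρ b - 1‖) Filter.atTop (nhds 0) := by
      simpa using (tendsto_pow_atTop_nhds_zero_of_lt_one hr0 hr1).mul_const ‖ρ b - 1‖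
    obtain ⟨ε, hε, hεg⟩ : ∃ ε > 0, ∀ g : G, ‖ρ g - 1‖ < ε → g = 1 := by
      by_contra hcon
      push Not at hcon
      obtain ⟨g1, -, hg1⟩ := hcon 1 one_pos
      have : Nonempty {g : G // g ≠ 1} := ⟨⟨g1, hg1⟩⟩
      obtain ⟨g0, hg0⟩ := Finite.exists_min (fun g : {g : G // g ≠ 1} => ‖ρ g.1 - 1‖)
      obtain ⟨g, hg1, hg2⟩ := hcon ‖ρ g0.1 - 1‖ (by
        rw [gt_iff_lt, norm_pos_iff, sub_ne_zero, ← map_one ρ]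
        exact fun h => g0.2 (hρ h))
      exact absurd hg1 (not_lt.mpr (hg0 ⟨g, hg2⟩))
    obtain ⟨N, hN⟩ := (htend.eventually (gt_mem_nhds hε)).exists
    exact ⟨N, hεg _ ((hBn N).trans_lt hN)⟩
  obtain ⟨N, hN⟩ := hfin
  have hdown : ∀ i, Commute a (B i) → Commute a b := by
    intro i
    induction i with
    | zero => exact id
    | succ k ih =>
      intro h
      apply ih
      apply jordan_comm_step ρ hρ hn a (B k) (hBs k)
      rw [hB] at h
      -- a commutes with a * (Bk a⁻¹ Bk⁻¹)
      have h2 : Commute a (a⁻¹ * (a * B k * a⁻¹ * (B k)⁻¹)) := ((Commute.refl a).inv_right).mul_right h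
      have h3 : (a⁻¹ * (a * B k * a⁻¹ * (B k)⁻¹))⁻¹ = B k * a * (B k)⁻¹ := by
        group
      rw [← h3]
      exact h2.inv_right
  exact hdown N (by rw [hN]; exact Commute.one_right a)

theorem jordan_normed [FiniteDimensional ℝ 𝔸] (hρ : Function.Injective ρ) (hn : ∀ g, ‖ρ g‖ ≤ 1) :
    ∃ A : Subgroup G, (∀ a ∈ A, ∀ b ∈ A, a * b = b * a) ∧
      A.index ≤ 5 ^ (Module.finrank ℝ 𝔸) := by
  set S : Set G := {g | ‖ρ g - 1‖ < 1 / 2} with hS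
  refine ⟨Subgroup.closure S, ?_, ?_⟩
  · have := Subgroup.isMulCommutative_closure (k := S) (fun x hx y hy =>
      (jordan_small_comm ρ hρ hn x y hx hy).eq)
    intro a ha b hb
    have := this.is_comm.comm ⟨a, ha⟩ ⟨b, hb⟩
    simpa using congrArg Subtype.val this
  · set A := Subgroup.closure S
    classical
    have := Fintype.ofFinite (G ⧸ A)
    let f : G ⧸ A → 𝔸 := fun q => (2 : ℂ) • ρ q.out
    have hsep : ∀ q q' : G ⧸ A, q ≠ q' → 1 ≤ ‖f q - f q'‖ := by
      intro q q' hne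
      by_contra hlt
      push Not at hlt
      apply hne
      have h1 : ‖ρ q.out - ρ q'.out‖ < 1 / 2 := by
        have : f q - f q' = (2 : ℂ) • (ρ q.out - ρ q'.out) := by simp only [f]; rw [smul_sub]
        rw [this, norm_smul] at hlt
        norm_num at hlt
        linarith
      have h2 : (q.out)⁻¹ * q'.out ∈ A := by
        apply Subgroup.subset_closure
        show ‖_‖ < _
        have : ρ ((q.out)⁻¹ * q'.out) - 1 = ρ (q.out)⁻¹ * (ρ q'.out - ρ q.out) := by
          rw [mul_sub, ← map_mul, ← map_mul]; simp
        rw [this]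
        refine (norm_mul_le _ _).trans_lt ?_
        refine (mul_le_of_le_one_left (norm_nonneg _) (hn _)).trans_lt ?_
        rwa [norm_sub_rev]
      have := QuotientGroup.eq.mpr h2
      simpa using this
    have hinj : Function.Injective f := by
      intro q q' h
      by_contra hne
      have := hsep q q' hne
      rw [h, sub_self, norm_zero] at this
      linarith
    have := Besicovitch.card_le_of_separated (E := 𝔸) (Finset.univ.image f) (by
      intro c hc
      obtain ⟨q, -, rfl⟩ := Finset.mem_image.mp hc
      simp only [f]
      rw [norm_smul]
      have := hn q.out
      norm_num
      exact this) (by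
      intro c hc d hd hne
      obtain ⟨q, -, rfl⟩ := Finset.mem_image.mp hc
      obtain ⟨q', -, rfl⟩ := Finset.mem_image.mp hd
      exact hsep q q' (fun h => hne (by rw [h])))
    rw [Finset.card_image_of_injective _ hinj, Finset.card_univ] at this
    rw [Subgroup.index, Nat.card_eq_fintype_card]
    exact this

end Jordan

theorem jordan_matrix (n : ℕ) {G : Type*} [Group G] [Finite G]
    (ρ : G →* Matrix (Fin n) (Fin n) ℂ) (hρ : Function.Injective ρ) :
    ∃ A : Subgroup G, (∀ a ∈ A, ∀ b ∈ A, a * b = b * a) ∧ A.index ≤ 5 ^ (2 * (n * n)) := by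
  classical
  have := Fintype.ofFinite G
  let ι : (Fin n → ℂ) →ₗ[ℂ] (G → Fin n → ℂ) := LinearMap.pi fun g => Matrix.toLin' (ρ g)
  have hι : Function.Injective ι := by
    intro v w h
    have := congrFun h 1
    simpa [ι] using this
  let e := LinearEquiv.ofInjective ι hι
  let E := LinearMap.range ι
  let Ψ : Matrix (Fin n) (Fin n) ℂ →* (E →L[ℂ] E) :=
    ((Module.End.toContinuousLinearMap E).toMulEquiv.toMonoidHom.comp
      ((e.conjAlgEquiv ℂ).toMulEquiv.toMonoidHom)).comp
      (Matrix.toLinAlgEquiv' (R := ℂ) (n := Fin n)).toMulEquiv.toMonoidHom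
  have hΨ : Function.Injective Ψ := by
    intro a b h
    exact (Matrix.toLinAlgEquiv' (R := ℂ) (n := Fin n)).injective
      ((e.conjAlgEquiv ℂ).injective ((Module.End.toContinuousLinearMap E).injective h))
  have hΨa : ∀ (M : Matrix (Fin n) (Fin n) ℂ) (v : Fin n → ℂ), Ψ M (e v) = e (M *ᵥ v) := by
    intro M v
    have : Ψ M (e v) = e (Matrix.toLin' M (e.symm (e v))) := rfl
    rw [this, e.symm_apply_apply, Matrix.toLin'_apply]
  have hnorm : ∀ g, ‖Ψ (ρ g)‖ ≤ 1 := by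
    intro x
    refine ContinuousLinearMap.opNorm_le_bound _ zero_le_one fun f => ?_
    obtain ⟨v, rfl⟩ := e.surjective f
    rw [hΨa, one_mul]
    show ‖(ι (ρ x *ᵥ v) : G → Fin n → ℂ)‖ ≤ ‖ι v‖
    rw [pi_norm_le_iff_of_nonneg (norm_nonneg _)]
    intro g
    have : ι (ρ x *ᵥ v) g = ι v (g * x) := by
      simp [ι, map_mul]
    rw [this]
    exact norm_le_pi_norm _ _
  obtain ⟨A, hA, hi⟩ := by
    have hfd : FiniteDimensional ℝ (E →L[ℂ] E) := FiniteDimensional.complexToReal _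
    exact @jordan_normed (E →L[ℂ] E) _ _ G _ _ (Ψ.comp ρ) hfd (by
      intro a b h
      exact hρ (hΨ h)) (fun g => hnorm g)
  refine ⟨A, hA, hi.trans (Nat.pow_le_pow_right (by norm_num) ?_)⟩
  refine (finrank_real_of_complex (E →L[ℂ] E)).le.trans ?_
  rw [← (LinearMap.toContinuousLinearMap (𝕜 := ℂ) (E := E) (F' := E)).finrank_eq,
    Module.finrank_linearMap, ← e.finrank_eq]
  simp

section Lift
variable {G : Type*} [Group G] [Fintype G]

lemma cobound {R : Type*} [Ring R] (N : R) (hN : N * (Fintype.card G : R) = 1)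
    (hNc : ∀ x, N * x = x * N)
    (ρ : G →* R) (c : G → G → R)
    (hc : ∀ g x y, c (g * x) y + c g x * ρ y = c g (x * y) + ρ g * c x y) (g x : G) :
    c g x + (- N * ∑ y, c g y * ρ y⁻¹) * ρ x + ρ g * (- N * ∑ y, c x y * ρ y⁻¹)
      - (- N * ∑ y, c (g * x) y * ρ y⁻¹) = 0 := by
  have hρ : ∀ y, ρ y * ρ y⁻¹ = 1 := fun y => by rw [← map_mul]; simp
  have h1 : ∑ y, c (g * x) y * ρ y⁻¹ + (Fintype.card G : R) * c g x
      = (∑ y, c g y * ρ y⁻¹) * ρ x + ρ g * ∑ y, c x y * ρ y⁻¹ := by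
    have e : ∀ y, c (g * x) y * ρ y⁻¹ + c g x = c g (x * y) * ρ (x * y)⁻¹ * ρ x
        + ρ g * (c x y * ρ y⁻¹) := by
      intro y
      have := congrArg (· * ρ y⁻¹) (hc g x y)
      simp only [add_mul, mul_assoc, hρ, mul_one] at this
      rw [this, mul_assoc, ← map_mul]
      simp
    have := Finset.sum_congr (s₁ := Finset.univ) rfl (fun y _ => e y)
    rw [Finset.sum_add_distrib, Finset.sum_add_distrib, Finset.sum_const, ← Finset.sum_mul,
      ← Finset.mul_sum, Finset.card_univ, nsmul_eq_mul] at this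
    rw [this]
    congr 2
    exact Fintype.sum_equiv (Equiv.mulLeft x) _ _ (fun y => rfl)
  have h2 := congrArg (N * ·) h1
  simp only [mul_add] at h2
  rw [← mul_assoc N (Fintype.card G : R), hN, one_mul, ← mul_assoc N, ← mul_assoc N, hNc (ρ g),
    mul_assoc (ρ g)] at h2
  simp only [neg_mul, mul_neg]
  rw [eq_sub_of_add_eq' h2]
  abel

variable (p : ℕ) [hp : Fact p.Prime] (n : ℕ)

lemma toZMod_eq_zero_iff (x : ℤ_[p]) : PadicInt.toZMod x = 0 ↔ (p : ℤ_[p]) ∣ x := by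
  rw [← RingHom.mem_ker, PadicInt.ker_toZMod, PadicInt.maximalIdeal_eq_span_p,
    Ideal.mem_span_singleton]

lemma map_eq_zero_iff_exists (M : Matrix (Fin n) (Fin n) ℤ_[p]) :
    (PadicInt.toZMod (p := p)).mapMatrix M = 0 ↔ ∃ M', M = (p : ℤ_[p]) • M' := by
  constructor
  · intro h
    have : ∀ i j, ∃ y, M i j = (p : ℤ_[p]) * y := by
      intro i j
      have := congrFun (congrFun h i) j
      exact (toZMod_eq_zero_iff p _).mp this
    choose M' hM' using this
    exact ⟨M', by ext1 i j; exact hM' i j⟩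
  · rintro ⟨M', rfl⟩
    ext i j
    simp

/-- approximate lifts modulo p^k -/
def ApproxLift (ρ : G →* Matrix (Fin n) (Fin n) (ZMod p)) (k : ℕ)
    (s : G → Matrix (Fin n) (Fin n) ℤ_[p]) : Prop :=
  (∀ g, (PadicInt.toZMod (p := p)).mapMatrix (s g) = ρ g) ∧
    ∀ g x, ∃ c, s g * s x = s (g * x) + (p : ℤ_[p]) ^ k • c

lemma approxLift_exists (hG : ¬ p ∣ Fintype.card G)
    (ρ : G →* Matrix (Fin n) (Fin n) (ZMod p)) (k : ℕ) : ∃ s, ApproxLift p n ρ (k + 1) s := by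
  induction k with
  | zero =>
    have hs : Function.Surjective (PadicInt.toZMod (p := p)) := ZMod.ringHom_surjective _
    choose t ht using hs
    refine ⟨fun g => (ρ g).map t, ?_, ?_⟩
    · intro g; ext i j; simp [ht]
    · intro g x
      have : (PadicInt.toZMod (p := p)).mapMatrix ((ρ g).map t * (ρ x).map t - (ρ (g * x)).map t) = 0 := by
        have e : ∀ g, (PadicInt.toZMod (p := p)).mapMatrix ((ρ g).map t) = ρ g := by
          intro g; ext i j; simp [ht]
        rw [map_sub, map_mul, e, e, e, map_mul, sub_self]
      obtain ⟨M, hM⟩ := (map_eq_zero_iff_exists p n _).mp this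
      exact ⟨M, by simpa using (sub_eq_iff_eq_add'.mp hM)⟩
  | succ k ih =>
    obtain ⟨s, hs1, hs2⟩ := ih
    choose c hc using hs2
    set r := (PadicInt.toZMod (p := p)).mapMatrix (m := Fin n) with hr
    have hpk : (p : ℤ_[p]) ^ (k + 1) ≠ 0 := pow_ne_zero _ (by exact_mod_cast hp.out.ne_zero)
    have hcoc : ∀ g x y, c (g * x) y + c g x * s y = c g (x * y) + s g * c x y := by
      intro g x y
      have e : s g * s x * s y = s g * (s x * s y) := mul_assoc _ _ _
      rw [hc g x, hc x y, add_mul, mul_add, hc, hc, smul_mul_assoc, mul_smul_comm, mul_assoc g,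
        add_assoc, add_assoc, ← smul_add, ← smul_add] at e
      exact smul_right_injective _ hpk (add_left_cancel e)
    have hcard : (Fintype.card G : ZMod p) ≠ 0 := by
      rwa [Ne, ZMod.natCast_eq_zero_iff]
    obtain ⟨N, hN⟩ := ZMod.ringHom_surjective (PadicInt.toZMod (p := p)) ((Fintype.card G : ZMod p)⁻¹)
    have key := cobound (R := Matrix (Fin n) (Fin n) (ZMod p)) (Matrix.scalar _ (Fintype.card G : ZMod p)⁻¹)
      (by
        have : (Fintype.card G : Matrix (Fin n) (Fin n) (ZMod p)) = Matrix.scalar _ (Fintype.card G : ZMod p) := by simp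
        rw [this, ← map_mul, inv_mul_cancel₀ hcard, map_one])
      (fun x => Matrix.scalar_commute _ (fun _ => Commute.all _ _) x)
      ρ (fun g x => r (c g x)) (by
        intro g x y
        have := congrArg r (hcoc g x y)
        simpa only [map_add, map_mul, hs1] using this)
    let b : G → Matrix (Fin n) (Fin n) ℤ_[p] := fun g => - Matrix.scalar _ N * ∑ y, c g y * s y⁻¹
    have hb : ∀ g, r (b g) = - Matrix.scalar _ (Fintype.card G : ZMod p)⁻¹ * ∑ y, r (c g y) * ρ y⁻¹ := by
      intro g
      have : r (Matrix.scalar _ N) = Matrix.scalar _ (Fintype.card G : ZMod p)⁻¹ := by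
        rw [← hN, hr]; ext i j
        simp [Matrix.diagonal_apply, apply_ite (PadicInt.toZMod (p := p))]
      simp only [b, map_mul, map_neg, map_sum, this, hs1]
    refine ⟨fun g => s g + (p : ℤ_[p]) ^ (k + 1) • b g, ?_, ?_⟩
    · intro g
      have : r ((p : ℤ_[p]) ^ (k + 1) • b g) = 0 := by
        rw [hr, map_eq_zero_iff_exists]
        exact ⟨(p : ℤ_[p]) ^ k • b g, by rw [smul_smul, pow_succ']⟩
      rw [map_add, this, add_zero, hs1]
    · intro g x
      have h0 : r (c g x + b g * s x + s g * b x - b (g * x)) = 0 := by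
        rw [map_sub, map_add, map_add, map_mul r (b g) (s x), map_mul r (s g) (b x), hb g, hb x, hb (g * x), hs1, hs1]
        exact key g x
      obtain ⟨M, hM⟩ := (map_eq_zero_iff_exists p n _).mp h0
      refine ⟨M + (p : ℤ_[p]) ^ k • (b g * b x), ?_⟩
      have hM' : c g x + b g * s x + s g * b x = (p : ℤ_[p]) • M + b (g * x) := by
        rw [← hM]; abel
      calc _ = s g * s x + (p : ℤ_[p]) ^ (k + 1) • (b g * s x + s g * b x)
              + (p : ℤ_[p]) ^ (k + 1 + 1) • (p : ℤ_[p]) ^ k • (b g * b x) := by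
            rw [add_mul, mul_add, mul_add, smul_mul_assoc, mul_smul_comm, smul_mul_assoc,
              mul_smul_comm, smul_smul, smul_smul, smul_add]
            rw [show (p : ℤ_[p]) ^ (k + 1 + 1) * (p : ℤ_[p]) ^ k = (p : ℤ_[p]) ^ (k + 1) * (p : ℤ_[p]) ^ (k + 1) by ring]
            abel
        _ = s (g * x) + (p : ℤ_[p]) ^ (k + 1) • (c g x + b g * s x + s g * b x)
              + (p : ℤ_[p]) ^ (k + 1 + 1) • (p : ℤ_[p]) ^ k • (b g * b x) := by
            rw [hc g x]; simp only [smul_add]; abel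
        _ = _ := by
            rw [hM']; simp only [smul_add, smul_smul]
            rw [show (p : ℤ_[p]) ^ (k + 1) * (p : ℤ_[p]) = (p : ℤ_[p]) ^ (k + 1 + 1) by ring]
            abel

lemma closed_dvd (a : ℤ_[p]) : IsClosed {x : ℤ_[p] | a ∣ x} := by
  have : {x : ℤ_[p] | a ∣ x} = Set.range (fun y => a * y) := by
    ext x; constructor
    · rintro ⟨y, rfl⟩; exact ⟨y, rfl⟩
    · rintro ⟨y, rfl⟩; exact ⟨y, rfl⟩
  rw [this]
  exact (isCompact_range (by fun_prop)).isClosed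

lemma approxLift_closed (ρ : G →* Matrix (Fin n) (Fin n) (ZMod p)) (k : ℕ) :
    IsClosed {s | ApproxLift p n ρ k s} := by
  obtain ⟨t, ht⟩ : ∃ t : ZMod p → ℤ_[p], ∀ x, PadicInt.toZMod (t x) = x :=
    ⟨_, fun x => Function.surjInv_eq (ZMod.ringHom_surjective _) x⟩
  have : {s | ApproxLift p n ρ k s} =
      (⋂ (g : G) (i : Fin n) (j : Fin n), {s | (p : ℤ_[p]) ∣ s g i j - t (ρ g i j)}) ∩
      ⋂ (g : G) (x : G) (i : Fin n) (j : Fin n),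
        {s | (p : ℤ_[p]) ^ k ∣ (s g * s x - s (g * x)) i j} := by
    ext s
    simp only [Set.mem_ofPred_eq, ApproxLift, Set.mem_inter_iff, Set.mem_iInter]
    refine and_congr (forall_congr' fun g => ?_) (forall_congr' fun g => forall_congr' fun x => ?_)
    · rw [← Matrix.ext_iff]
      refine forall_congr' fun i => forall_congr' fun j => ?_
      rw [← toZMod_eq_zero_iff, map_sub, ht, sub_eq_zero]
      rfl
    · constructor
      · rintro ⟨c, hc⟩ i j
        rw [hc, add_sub_cancel_left]
        exact ⟨c i j, rfl⟩
      · intro h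
        choose c hc using h
        refine ⟨c, ?_⟩
        rw [← sub_eq_iff_eq_add']
        ext1 i j
        exact hc i j
  rw [this]
  refine IsClosed.inter ?_ ?_
  · refine isClosed_iInter fun g => isClosed_iInter fun i => isClosed_iInter fun j => ?_
    exact (closed_dvd p _).preimage (f := fun s : G → Matrix (Fin n) (Fin n) ℤ_[p] => s g i j - t (ρ g i j)) (by fun_prop)
  · refine isClosed_iInter fun g => isClosed_iInter fun x => isClosed_iInter fun i =>
      isClosed_iInter fun j => ?_
    exact (closed_dvd p _).preimage (f := fun s : G → Matrix (Fin n) (Fin n) ℤ_[p] => (s g * s x - s (g * x)) i j) (by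
      simp only [Matrix.sub_apply, Matrix.mul_apply]
      fun_prop)

lemma exists_lift (hG : ¬ p ∣ Fintype.card G)
    (ρ : G →* Matrix (Fin n) (Fin n) (ZMod p)) (hρ : Function.Injective ρ) :
    ∃ s : G →* Matrix (Fin n) (Fin n) ℤ_[p], Function.Injective s := by
  have hcpt : CompactSpace (G → Matrix (Fin n) (Fin n) ℤ_[p]) := by
    have h1 : CompactSpace (Matrix (Fin n) (Fin n) ℤ_[p]) :=
      inferInstanceAs (CompactSpace (Fin n → Fin n → ℤ_[p]))
    exact @Pi.compactSpace G (fun _ => Matrix (Fin n) (Fin n) ℤ_[p]) _ (fun _ => h1)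
  obtain ⟨s, hs⟩ := IsCompact.nonempty_iInter_of_sequence_nonempty_isCompact_isClosed
    (fun k => {s | ApproxLift p n ρ (k + 1) s})
    (by
      intro k s hs
      refine ⟨hs.1, fun g x => ?_⟩
      obtain ⟨c, hc⟩ := hs.2 g x
      exact ⟨(p : ℤ_[p]) • c, by rw [hc, smul_smul, ← pow_succ]⟩)
    (fun k => approxLift_exists p n hG ρ k)
    (approxLift_closed p n ρ _).isCompact (fun k => approxLift_closed p n ρ _)
  rw [Set.mem_iInter] at hs
  have hmul : ∀ g x, s g * s x = s (g * x) := by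
    intro g x
    rw [← sub_eq_zero]
    ext1 i j
    have : ∀ k, (p : ℤ_[p]) ^ (k + 1) ∣ (s g * s x - s (g * x)) i j := by
      intro k
      obtain ⟨c, hc⟩ := (hs k).2 g x
      rw [hc, add_sub_cancel_left]
      exact ⟨c i j, rfl⟩
    by_contra hne
    have hpos := norm_pos_iff.mpr hne
    have h1 : (1 : ℝ) < p := by exact_mod_cast hp.out.one_lt
    have hlt : ((p : ℝ)⁻¹) < 1 := inv_lt_one_of_one_lt₀ h1
    obtain ⟨k, hk⟩ := exists_pow_lt_of_lt_one hpos hlt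
    obtain ⟨y, hy⟩ := this k
    have h2 : ‖(s g * s x - s (g * x)) i j‖ ≤ ((p : ℝ)⁻¹) ^ (k + 1) := by
      rw [hy, norm_mul, norm_pow, PadicInt.norm_p]
      exact mul_le_of_le_one_right (by positivity) (PadicInt.norm_le_one y)
    have h3 : ((p : ℝ)⁻¹) ^ (k + 1) ≤ ((p : ℝ)⁻¹) ^ k :=
      pow_le_pow_of_le_one (by positivity) hlt.le (Nat.le_succ k)
    linarith
  have hred := (hs 0).1
  have hone : s 1 = 1 := by
    -- s 1 is idempotent and invertible
    have hi : s 1 * s 1 = s 1 := by rw [hmul, one_mul]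
    have hdet : IsUnit (s 1).det := by
      have h1 : PadicInt.toZMod (p := p) (s 1).det = 1 := by
        rw [RingHom.map_det, hred, map_one, det_one]
      by_contra hnu
      have : PadicInt.toZMod (p := p) (s 1).det = 0 := by
        rw [← RingHom.mem_ker, PadicInt.ker_toZMod]
        exact (IsLocalRing.mem_maximalIdeal _).mpr hnu
      rw [this] at h1
      exact zero_ne_one h1
    have hu := (Matrix.isUnit_iff_isUnit_det _).mpr hdet
    exact hu.mul_left_cancel (by rw [hi, mul_one])
  refine ⟨{ toFun := s, map_one' := hone, map_mul' := fun g x => (hmul g x).symm }, ?_⟩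
  intro g x h
  apply hρ
  rw [← hred, ← hred]
  exact congrArg _ h

lemma padic_to_complex : Nonempty (ℚ_[p] →+* ℂ) := by
  have hcard : Cardinal.mk ℚ_[p] ≤ Cardinal.continuum := by
    have h1 : Cardinal.mk ℚ_[p] ≤ Cardinal.mk (CauSeq ℚ (padicNorm p)) := Cardinal.mk_quotient_le
    have h2 : Cardinal.mk (CauSeq ℚ (padicNorm p)) ≤ Cardinal.mk (ℕ → ℚ) := Cardinal.mk_subtype_le _
    refine h1.trans (h2.trans ?_)
    simp
  have hcard2 : Cardinal.continuum ≤ Cardinal.mk ℚ_[p] := by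
    exact continuum_le_cardinal_of_nontriviallyNormedField ℚ_[p]
  have e1 : Cardinal.mk (AlgebraicClosure ℚ_[p]) = Cardinal.continuum := by
    apply le_antisymm
    · refine (Algebra.IsAlgebraic.cardinalMk_le_max ℚ_[p] _).trans ?_
      exact max_le hcard Cardinal.aleph0_le_continuum
    · exact hcard2.trans (Cardinal.mk_le_of_injective (algebraMap ℚ_[p] (AlgebraicClosure ℚ_[p])).injective)
  have : CharZero (AlgebraicClosure ℚ_[p]) := charZero_of_injective_algebraMap (algebraMap ℚ_[p] (AlgebraicClosure ℚ_[p])).injective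
  have e2 : Nonempty (AlgebraicClosure ℚ_[p] ≃ ℂ) := by
    apply Cardinal.eq.mp
    rw [e1, Cardinal.mk_complex]
  obtain ⟨f⟩ := IsAlgClosed.ringEquiv_of_equiv_of_charZero (by rw [e1]; exact Cardinal.aleph0_lt_continuum) e2
  exact ⟨f.toRingHom.comp (algebraMap _ _)⟩

theorem jordan_mod (hG : ¬ p ∣ Fintype.card G)
    (ρ : G →* Matrix (Fin n) (Fin n) (ZMod p)) (hρ : Function.Injective ρ) :
    ∃ A : Subgroup G, (∀ a ∈ A, ∀ b ∈ A, a * b = b * a) ∧ A.index ≤ 5 ^ (2 * (n * n)) := by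
  obtain ⟨s, hs⟩ := exists_lift p n hG ρ hρ
  obtain ⟨f⟩ := padic_to_complex p
  let φ : ℤ_[p] →+* ℂ := f.comp (PadicInt.Coe.ringHom)
  have hφ : Function.Injective φ := f.injective.comp Subtype.val_injective
  refine jordan_matrix n ((φ.mapMatrix : Matrix (Fin n) (Fin n) ℤ_[p] →+* _).toMonoidHom.comp s) ?_
  exact (Matrix.map_injective hφ).comp hs

end Lift

lemma exists_core (Γ : Type*) [Group Γ] [hfg : Group.FG Γ] (J : ℕ) :
    ∃ K : Subgroup Γ, K.FiniteIndex ∧ ∀ A : Subgroup Γ, A.FiniteIndex → A.index ≤ J → K ≤ A := by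
  classical
  obtain ⟨S, hS, hfin⟩ := Group.fg_iff.mp hfg
  have hfinhom : ∀ j : ℕ, Finite (Γ →* Equiv.Perm (Fin j)) := by
    intro j
    have : Finite S := hfin
    refine Finite.of_injective (fun (f : Γ →* Equiv.Perm (Fin j)) (s : S) => f s) ?_
    intro f g h
    apply MonoidHom.eq_of_eqOn_dense hS
    intro s hs
    exact congrFun h ⟨s, hs⟩
  let K : Subgroup Γ := ⨅ j : Fin (J + 1), ⨅ f : Γ →* Equiv.Perm (Fin j), f.ker
  refine ⟨K, ?_, ?_⟩
  · refine Subgroup.finiteIndex_iInf fun j => ?_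
    have := hfinhom j
    refine Subgroup.finiteIndex_iInf fun f => ?_
    exact Subgroup.finiteIndex_ker f
  · intro A hA hJ
    have hfinq : Finite (Γ ⧸ A) := Subgroup.finite_quotient_of_finiteIndex
    have e : (Γ ⧸ A) ≃ Fin A.index := Finite.equivFin _
    have h1 : K ≤ ((e.permCongrHom.toMonoidHom).comp (MulAction.toPermHom Γ (Γ ⧸ A))).ker :=
      (iInf_le _ (⟨A.index, by omega⟩ : Fin (J + 1))).trans (iInf_le _ _)
    refine h1.trans ?_
    intro x hx
    apply Subgroup.normalCore_le A
    rw [Subgroup.normalCore_eq_ker]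
    rw [MonoidHom.mem_ker] at hx ⊢
    exact e.permCongrHom.injective (hx.trans (map_one e.permCongrHom).symm)

theorem caseB_finite (n : ℕ) (H : Subgroup (SL n ℤ)) (hFG : H.FG) (hsbf : ¬ SolvableByFinite H) :
    {p : ℕ | p.Prime ∧ ¬ p ∣ Nat.card (H.map (redMod n p))}.Finite := by
  classical
  by_contra hinf
  apply hsbf
  have : Group.FG H := (Group.fg_iff_subgroup_fg H).mpr hFG
  obtain ⟨K, hK, hKA⟩ := exists_core H (5 ^ (2 * (n * n)))
  refine ⟨K, ?_, hK⟩
  have hcomm : ∀ a b : K, a * b = b * a := by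
    intro a b
    have key : ∀ p ∈ {p : ℕ | p.Prime ∧ ¬ p ∣ Nat.card (H.map (redMod n p))},
        redMod n p ((a : H) * (b : H) : H) = redMod n p ((b : H) * (a : H) : H) := by
      rintro p ⟨hp, hpc⟩
      have : Fact p.Prime := ⟨hp⟩
      have : Fintype (H.map (redMod n p)) := Fintype.ofFinite _
      rw [Nat.card_eq_fintype_card] at hpc
      let ρ : (H.map (redMod n p)) →* Matrix (Fin n) (Fin n) (ZMod p) :=
        { toFun := fun g => ((g : SL n (ZMod p)) : Matrix _ _ _)
          map_one' := rfl
          map_mul' := fun _ _ => rfl }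
      obtain ⟨A, hA, hAi⟩ := jordan_mod p n hpc ρ (by
        intro x y h
        exact Subtype.ext (Subtype.ext h))
      let r : H →* H.map (redMod n p) := (redMod n p).subgroupMap H
      have hr : Function.Surjective r := (redMod n p).subgroupMap_surjective H
      have hi : (A.comap r).index = A.index := Subgroup.index_comap_of_surjective A hr
      have hAf : (A.comap r).FiniteIndex := ⟨by rw [hi]; exact Subgroup.FiniteIndex.index_ne_zero⟩
      have hle := hKA _ hAf (by rw [hi]; exact hAi)
      have h2 := hA _ (hle a.2) _ (hle b.2)
      rw [← map_mul, ← map_mul] at h2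
      exact congrArg Subtype.val h2
    apply Subtype.ext
    apply Subtype.ext
    apply Subtype.ext
    ext i j
    set x : SL n ℤ := (((a : H) * (b : H) : H) : SL n ℤ)
    set y : SL n ℤ := (((b : H) * (a : H) : H) : SL n ℤ)
    show x i j = y i j
    have hdvd : ∀ p ∈ {p : ℕ | p.Prime ∧ ¬ p ∣ Nat.card (H.map (redMod n p))},
        (p : ℤ) ∣ x i j - y i j := by
      intro p hp
      have := congrArg (fun g : SL n (ZMod p) => g i j) (key p hp)
      rw [← ZMod.intCast_zmod_eq_zero_iff_dvd, Int.cast_sub, sub_eq_zero]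
      exact this
    by_contra hne
    apply hinf
    refine (Set.finite_Iic (x i j - y i j).natAbs).subset ?_
    intro p hp
    exact Nat.le_of_dvd (Int.natAbs_pos.mpr (sub_ne_zero.mpr hne)) (Int.natCast_dvd.mp (hdvd p hp))
  have : IsMulCommutative K := ⟨⟨hcomm⟩⟩
  exact isSolvable_of_comm hcomm

open Polynomial in
lemma exists_bezout_int (n : ℕ) [hn : Fact n.Prime] (g : ℤ[X]) (hg0 : g ≠ 0) (hdeg : g.natDegree < n)
    (hg1 : g.eval 1 = 0) : ∃ (m : ℤ) (a b : ℤ[X]), m ≠ 0 ∧ a * g + b * cyclotomic n ℤ = C m := by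
  have hinj : Function.Injective (algebraMap ℤ ℚ) := RingHom.injective_int _
  have hmi := Polynomial.map_injective (algebraMap ℤ ℚ) hinj
  set G := g.map (algebraMap ℤ ℚ) with hG
  have hG0 : G ≠ 0 := fun h => hg0 (hmi (by rw [← hG, h, Polynomial.map_zero]))
  have hirr := cyclotomic.irreducible_rat hn.out.pos
  have hmc : (cyclotomic n ℤ).map (algebraMap ℤ ℚ) = cyclotomic n ℚ := map_cyclotomic _ _
  have hcop : IsCoprime (cyclotomic n ℚ) G := by
    rw [hirr.coprime_iff_not_dvd]
    rintro ⟨q, hq⟩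
    have hq0 : q ≠ 0 := by rintro rfl; rw [mul_zero] at hq; exact hG0 hq
    have hd : G.natDegree = (n - 1) + q.natDegree := by
      rw [hq, natDegree_mul (cyclotomic_ne_zero _ _) hq0, natDegree_cyclotomic,
        Nat.totient_prime hn.out]
    have hGd : G.natDegree = g.natDegree := natDegree_map_eq_of_injective hinj g
    have hq1 : q.natDegree = 0 := by omega
    obtain ⟨c, rfl⟩ := natDegree_eq_zero.mp hq1
    have he : G.eval 1 = 0 := by
      rw [hG, eval_map, ← map_one (algebraMap ℤ ℚ), eval₂_hom, hg1, map_zero]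
    rw [hq, eval_mul, eval_one_cyclotomic_prime, eval_C] at he
    rcases mul_eq_zero.mp he with h | h
    · exact hn.out.ne_zero (by exact_mod_cast h)
    · subst h; simp at hq0
  obtain ⟨v, u, huv⟩ := hcop
  obtain ⟨b1, hb1, h1⟩ := IsLocalization.integerNormalization_spec (nonZeroDivisors ℤ) u
  obtain ⟨b2, hb2, h2⟩ := IsLocalization.integerNormalization_spec (nonZeroDivisors ℤ) v
  refine ⟨b1 * b2, C b2 * IsLocalization.integerNormalization (nonZeroDivisors ℤ) u,
    C b1 * IsLocalization.integerNormalization (nonZeroDivisors ℤ) v,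
    mul_ne_zero (nonZeroDivisors.ne_zero hb1) (nonZeroDivisors.ne_zero hb2), hmi ?_⟩
  have e1 : b1 • u = C (b1 : ℚ) * u := by rw [zsmul_eq_mul]; simp
  have e2 : b2 • v = C (b2 : ℚ) * v := by rw [zsmul_eq_mul]; simp
  simp only [Polynomial.map_add, Polynomial.map_mul, h1, h2, hmc, map_C, ← hG, e1, e2]
  simp only [algebraMap_int_eq, eq_intCast, Int.cast_mul, C_mul]
  linear_combination (C (b1 : ℚ) * C (b2 : ℚ)) * huv

open Polynomial in
theorem galois_roots (n : ℕ) (hn : n.Prime) (hodd : Odd n) (f : ℚ[X]) (hf : Irreducible f)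
    (hm : f.Monic) (hd : f.natDegree = n) (h0 : f.coeff 0 = -1) :
    ∃ l : Fin n → f.SplittingField, f.map (algebraMap ℚ f.SplittingField) = ∏ i, (X - C (l i)) ∧
      ∀ i j k m, i ≠ j → l i * l m = l j * l k → i = k ∧ j = m := by
  classical
  have hnf : Fact n.Prime := ⟨hn⟩
  set K := f.SplittingField with hK
  obtain ⟨σ, hσ⟩ := exists_prime_orderOf_dvd_card' (G := f.Gal) n
    (hd ▸ Gal.prime_degree_dvd_card hf (hd.symm ▸ hn))
  let s : K ≃ₐ[ℚ] K := σ
  have hs1 : orderOf s = n := hσ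
  obtain ⟨x, hx, hsx⟩ : ∃ x ∈ f.rootSet K, s x ≠ x := by
    by_contra hcon
    push Not at hcon
    have : σ = 1 := Gal.ext f (fun x hx => hcon x hx)
    rw [this, orderOf_one] at hσ
    exact hn.one_lt.ne hσ
  have hpow : ∀ k y, (s^[k]) y = (s ^ k) y := by
    intro k y
    exact (congrFun (AlgEquiv.coe_pow s k) y).symm
  have hper : Function.minimalPeriod s x = n := by
    apply Function.minimalPeriod_eq_prime
    · show s^[n] x = x
      rw [hpow, ← hs1, pow_orderOf_eq_one]; rfl
    · exact hsx
  let l : Fin n → K := fun i => s^[i] x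
  have hlinj : Function.Injective l := by
    intro i j h
    have := Function.iterate_injOn_Iio_minimalPeriod (f := s) (x := x)
      (show (i : ℕ) ∈ _ by rw [hper]; exact i.2) (show (j : ℕ) ∈ _ by rw [hper]; exact j.2) h
    exact Fin.ext this
  have hf0 : f ≠ 0 := hf.ne_zero
  set F := f.map (algebraMap ℚ K) with hF
  have hFm : F.Monic := hm.map _
  have hFd : F.natDegree = n := by rw [hF, natDegree_map, hd]
  have hxr : aeval x f = 0 := (mem_rootSet.mp hx).2
  have hlr : ∀ i, l i ∈ F.roots := by
    intro i
    rw [mem_roots hFm.ne_zero, IsRoot, hF, eval_map_algebraMap]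
    show aeval (s^[i] x) f = 0
    rw [hpow]
    have := aeval_algHom_apply ((s ^ (i : ℕ) : K ≃ₐ[ℚ] K) : K →ₐ[ℚ] K) x f
    rw [hxr, map_zero] at this
    exact this
  have hroots : F.roots = Finset.univ.val.map l := by
    symm
    apply Multiset.eq_of_le_of_card_le
    · rw [Multiset.le_iff_subset (Multiset.Nodup.map hlinj Finset.univ.nodup)]
      intro y hy
      obtain ⟨i, _, rfl⟩ := Multiset.mem_map.mp hy
      exact hlr i
    · refine (card_roots' F).trans ?_
      simp [hFd]
  have hprod : F = ∏ i, (X - C (l i)) := by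
    have := prod_multiset_X_sub_C_of_monic_of_roots_card_eq hFm (by rw [hroots, hFd]; simp)
    rw [← this, hroots, Multiset.map_map]
    rfl
  refine ⟨l, hprod, ?_⟩
  have hl1 : ∏ i, l i = 1 := by
    have h := congrArg (eval 0) hprod
    rw [← coeff_zero_eq_eval_zero, hF, coeff_map, h0, eval_prod] at h
    simp only [eval_sub, eval_X, eval_C, zero_sub, map_neg, map_one] at h
    rw [Finset.prod_neg, Finset.card_univ, Fintype.card_fin, hodd.neg_one_pow, neg_one_mul] at h
    exact (neg_injective h).symm
  have hx0 : x ≠ 0 := by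
    rintro rfl
    exact hsx (map_zero s)
  let u : Kˣ := Units.mk0 x hx0
  let S : Additive Kˣ →ₗ[ℤ] Additive Kˣ :=
    (MonoidHom.toAdditive (Units.map (s : K →* K))).toIntLinearMap
  have hS : ∀ k, (((S ^ k) (Additive.ofMul u)).toMul : K) = s^[k] x := by
    intro k
    induction k with
    | zero => rfl
    | succ k ih =>
      rw [pow_succ', Function.iterate_succ_apply', ← ih]
      rfl
  have hSl : ∀ i : Fin n, (((S ^ (i : ℕ)) (Additive.ofMul u)).toMul : K) = l i := fun i => hS i
  have hcyc : aeval S (cyclotomic n ℤ) (Additive.ofMul u) = 0 := by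
    rw [cyclotomic_prime, map_sum, LinearMap.sum_apply, Finset.sum_range]
    simp only [map_pow, aeval_X]
    apply Additive.toMul.injective
    apply Units.ext
    rw [toMul_sum, Units.coe_prod]
    simp only [hSl]
    exact hl1
  intro i j k m hij hrel
  by_contra hne
  let g : ℤ[X] := X ^ (i : ℕ) + X ^ (m : ℕ) - X ^ (j : ℕ) - X ^ (k : ℕ)
  have hgc : ∀ t, g.coeff t = (if t = i then 1 else 0) + (if t = m then 1 else 0)
      - (if t = j then 1 else 0) - (if t = k then 1 else 0) := by
    intro t; simp [g, coeff_X_pow]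
  have hg0 : g ≠ 0 := by
    intro h
    have h1 := hgc i
    have h2 := hgc j
    rw [h, coeff_zero] at h1 h2
    simp only [Fin.val_inj] at h1 h2
    rw [if_pos trivial, if_neg hij] at h1
    rw [if_pos trivial, if_neg hij.symm] at h2
    by_cases e1 : i = k
    · by_cases e2 : j = m
      · exact hne ⟨e1, e2⟩
      · rw [if_neg e2] at h2
        split_ifs at h2 <;> omega
    · rw [if_neg e1] at h1
      split_ifs at h1 <;> omega
  have hgd : g.natDegree < n := by
    have hpos := hn.pos
    rw [natDegree_lt_iff_degree_lt hg0, degree_lt_iff_coeff_zero]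
    intro t ht
    rw [hgc]
    have := i.2; have := j.2; have := k.2; have := m.2
    rw [if_neg (by omega), if_neg (by omega), if_neg (by omega), if_neg (by omega)]
    norm_num
  have hg1 : g.eval 1 = 0 := by simp [g]
  have hgS : aeval S g (Additive.ofMul u) = 0 := by
    simp only [g, map_add, map_sub, map_pow, aeval_X, LinearMap.add_apply, LinearMap.sub_apply]
    rw [sub_sub, sub_eq_zero]
    apply Additive.toMul.injective
    apply Units.ext
    rw [toMul_add, toMul_add, Units.val_mul, Units.val_mul, hSl, hSl, hSl, hSl]
    exact hrel
  obtain ⟨c, a, b, hc0, hab⟩ := exists_bezout_int n g hg0 hgd hg1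
  have hfin : c • Additive.ofMul u = 0 := by
    have h := congrArg (fun q => aeval S q (Additive.ofMul u)) hab
    simp only [map_add, map_mul, LinearMap.add_apply, Module.End.mul_apply, hgS, hcyc, map_zero,
      add_zero, aeval_C] at h
    exact h.symm
  have hun : IsOfFinOrder u := by
    rw [isOfFinOrder_iff_zpow_eq_one]
    exact ⟨c, hc0, hfin⟩
  have hxf : IsOfFinOrder x := by
    exact (MonoidHom.isOfFinOrder (Units.coeHom K) hun)
  have hprim := IsPrimitiveRoot.orderOf x
  have hpos := hxf.orderOf_pos
  have hmin := cyclotomic_eq_minpoly_rat hprim hpos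
  rw [← minpoly.eq_of_irreducible_of_monic hf hxr hm] at hmin
  have hdeg := congrArg natDegree hmin
  rw [natDegree_cyclotomic, hd] at hdeg
  rcases lt_or_ge 2 (orderOf x) with h | h
  · have := Nat.totient_even h
    rw [hdeg] at this
    exact (Nat.not_even_iff_odd.mpr hodd) this
  · have h1 := hn.one_lt
    have : (orderOf x).totient = 1 := by
      interval_cases (orderOf x) <;> simp
    omega

section Burnside
open Polynomial Module
variable {F V : Type*} [Field F] [AddCommGroup V] [Module F V] [FiniteDimensional F V]

lemma aeval_inv_of_irr (T : End F V) (hT : Irreducible T.charpoly) (q : F[X]) (hq : aeval T q ≠ 0) :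
    ∃ u : F[X], aeval T u * aeval T q = 1 := by
  have : IsCoprime T.charpoly q := by
    rw [hT.coprime_iff_not_dvd]
    rintro ⟨r, rfl⟩
    rw [map_mul, LinearMap.aeval_self_charpoly, zero_mul] at hq
    exact hq rfl
  obtain ⟨a, b, hab⟩ := this
  refine ⟨b, ?_⟩
  have := congrArg (aeval T) hab
  simpa [LinearMap.aeval_self_charpoly] using this

lemma finrank_adjoin_of_irr (T : End F V) (hT : Irreducible T.charpoly) :
    finrank F (Algebra.adjoin F {T}) = finrank F V := by
  have hnt : Nontrivial (End F V) := by
    have h1 : T.charpoly.natDegree ≠ 0 := hT.natDegree_pos.ne'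
    rw [LinearMap.charpoly_natDegree] at h1
    have := Module.nontrivial_of_finrank_pos (R := F) (M := V) (Nat.pos_of_ne_zero h1)
    infer_instance
  have hker : RingHom.ker (aeval (R := F) T) = Ideal.span {T.charpoly} := by
    ext q
    rw [RingHom.mem_ker, Ideal.mem_span_singleton]
    constructor
    · intro hq
      by_contra hnd
      obtain ⟨a, b, hab⟩ := (hT.coprime_iff_not_dvd).mpr hnd
      have := congrArg (aeval T) hab
      simp [LinearMap.aeval_self_charpoly, hq] at this
    · rintro ⟨r, rfl⟩
      rw [map_mul, LinearMap.aeval_self_charpoly, zero_mul]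
  rw [Algebra.adjoin_singleton_eq_range_aeval]
  let e1 := Ideal.quotientKerEquivRange (aeval (R := F) T)
  let e2 := Ideal.quotientEquivAlgOfEq F hker
  rw [← e1.toLinearEquiv.finrank_eq, e2.toLinearEquiv.finrank_eq, ← LinearMap.charpoly_natDegree T]
  exact finrank_quotient_span_eq_natDegree

lemma cyclic_of_irr (T : End F V) (hT : Irreducible T.charpoly) (v : V) (hv : v ≠ 0) (w : V) :
    ∃ q : F[X], aeval T q v = w := by
  let L : Algebra.adjoin F {T} →ₗ[F] V :=
    (LinearMap.applyₗ v).comp (Subalgebra.val (Algebra.adjoin F {T})).toLinearMap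
  have hL : Function.Injective L := by
    rw [injective_iff_map_eq_zero]
    rintro ⟨a, ha⟩ h
    have ha' := ha
    rw [Algebra.adjoin_singleton_eq_range_aeval] at ha'
    obtain ⟨q, rfl⟩ := ha'
    by_contra hne
    have hq : aeval T q ≠ 0 := fun h => hne (Subtype.ext h)
    obtain ⟨u, hu⟩ := aeval_inv_of_irr T hT q hq
    have h' : aeval T q v = 0 := h
    have := congrArg (fun e : End F V => e v) hu
    simp only [End.mul_apply, h', map_zero, End.one_apply] at this
    exact hv this.symm
  have hsurj := (LinearMap.injective_iff_surjective_of_finrank_eq_finrank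
    (finrank_adjoin_of_irr T hT)).mp hL
  obtain ⟨⟨a, ha⟩, h⟩ := hsurj w
  rw [Algebra.adjoin_singleton_eq_range_aeval] at ha
  obtain ⟨q, rfl⟩ := ha
  exact ⟨q, h⟩

lemma centralizer_of_irr (T : End F V) (hT : Irreducible T.charpoly) [Nontrivial V] (x : End F V)
    (hx : x * T = T * x) : ∃ q : F[X], x = aeval T q := by
  obtain ⟨v, hv⟩ := exists_ne (0 : V)
  obtain ⟨q, hq⟩ := cyclic_of_irr T hT v hv (x v)
  refine ⟨q, LinearMap.ext fun w => ?_⟩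
  obtain ⟨r, rfl⟩ := cyclic_of_irr T hT v hv w
  have hc : Commute x (aeval T r) := by
    have hmem : aeval T r ∈ Subalgebra.centralizer F {x} := by
      have : Algebra.adjoin F {T} ≤ Subalgebra.centralizer F {x} := by
        apply Algebra.adjoin_le
        rintro _ rfl
        rw [SetLike.mem_coe, Subalgebra.mem_centralizer_iff]
        rintro _ rfl
        exact hx
      exact this (by rw [Algebra.adjoin_singleton_eq_range_aeval]; exact ⟨r, rfl⟩)
    rw [Subalgebra.mem_centralizer_iff] at hmem
    exact hmem x rfl
  have h1 : x (aeval T r v) = aeval T r (x v) := congrArg (fun e : End F V => e v) hc.eq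
  rw [h1, ← hq]
  have h2 : aeval T q * aeval T r = aeval T r * aeval T q := by rw [← map_mul, ← map_mul, mul_comm]
  exact (congrArg (fun e : End F V => e v) h2).symm

theorem burnside_prime (hp : (finrank F V).Prime) (T : End F V) (hT : Irreducible T.charpoly)
    (A : Subalgebra F (End F V)) (hTA : T ∈ A) (hnc : ∃ a ∈ A, ∃ b ∈ A, a * b ≠ b * a) : A = ⊤ := by
  classical
  have hnt : Nontrivial V := Module.nontrivial_of_finrank_pos hp.pos
  let E := Algebra.adjoin F {T}
  have hE : ∀ x, x ∈ E ↔ ∃ q : F[X], x = aeval T q := by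
    intro x
    show x ∈ Algebra.adjoin F {T} ↔ _
    rw [Algebra.adjoin_singleton_eq_range_aeval]
    exact ⟨fun ⟨q, h⟩ => ⟨q, h.symm⟩, fun ⟨q, h⟩ => ⟨q, h.symm⟩⟩
  have hdom : IsDomain E := by
    have : NoZeroDivisors E := by
      constructor
      rintro ⟨a, ha⟩ ⟨b, hb⟩ hab
      by_contra! hne
      obtain ⟨q, rfl⟩ := (hE _).mp ha
      obtain ⟨u, hu⟩ := aeval_inv_of_irr T hT q (fun h => hne.1 (Subtype.ext h))
      have hab' : aeval T q * b = 0 := congrArg Subtype.val hab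
      apply hne.2
      apply Subtype.ext
      show b = 0
      rw [← one_mul b, ← hu, mul_assoc, hab', mul_zero]
    exact NoZeroDivisors.to_isDomain E
  have hsimple : IsSimpleOrder (Subalgebra F E) :=
    Subalgebra.isSimpleOrder_of_finrank_prime F E (by rw [finrank_adjoin_of_irr T hT]; exact hp)
  let D : Subalgebra F E := (Subalgebra.centralizer F (A : Set (End F V))).comap E.val
  rcases hsimple.eq_bot_or_eq_top D with hD | hD
  · have hsm : IsSimpleModule A V := by
      rw [isSimpleModule_iff_toSpanSingleton_surjective]
      refine ⟨hnt, fun v hv w => ?_⟩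
      obtain ⟨q, hq⟩ := cyclic_of_irr T hT v hv w
      have hqA : aeval T q ∈ A := by
        have : E ≤ A := Algebra.adjoin_le (by simpa using hTA)
        exact this ((hE _).mpr ⟨q, rfl⟩)
      exact ⟨⟨_, hqA⟩, hq⟩
    have hend : ∀ e : End A V, ∃ c : F, ∀ v, e v = c • v := by
      intro e
      let e' : End F V := e.restrictScalars F
      have hce : ∀ a ∈ A, a * e' = e' * a := by
        intro a ha
        ext v
        exact (e.map_smul ⟨a, ha⟩ v).symm
      obtain ⟨q, hq⟩ := centralizer_of_irr T hT e' (hce T hTA).symm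
      have hmem : (⟨e', (hE _).mpr ⟨q, hq⟩⟩ : E) ∈ D := by
        show e' ∈ Subalgebra.centralizer F (A : Set (End F V))
        rw [Subalgebra.mem_centralizer_iff]
        exact hce
      rw [hD, Algebra.mem_bot] at hmem
      obtain ⟨c, hc⟩ := hmem
      refine ⟨c, fun v => ?_⟩
      have : algebraMap F (End F V) c = e' := congrArg Subtype.val hc
      have := congrArg (fun x : End F V => x v) this
      exact this.symm
    rw [eq_top_iff]
    rintro x -
    let x' : End (End A V) V :=
      { toFun := x
        map_add' := map_add x
        map_smul' := by
          intro e v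
          obtain ⟨c, hc⟩ := hend e
          show x (e v) = e (x v)
          rw [hc, hc, map_smul] }
    let b := Module.finBasis F V
    obtain ⟨r, hr⟩ := jacobson_density x' (Finset.univ.image b)
    have : x = r := by
      apply b.ext
      intro i
      exact hr (b i) (Finset.mem_image_of_mem _ (Finset.mem_univ i))
    rw [this]
    exact r.2
  · exfalso
    have hTD : (⟨T, Algebra.self_mem_adjoin_singleton F T⟩ : E) ∈ D := by rw [hD]; trivial
    have hTc : T ∈ Subalgebra.centralizer F (A : Set (End F V)) := hTD
    rw [Subalgebra.mem_centralizer_iff] at hTc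
    obtain ⟨a, ha, b, hb, hab⟩ := hnc
    obtain ⟨q, rfl⟩ := centralizer_of_irr T hT a (hTc a ha)
    obtain ⟨r, rfl⟩ := centralizer_of_irr T hT b (hTc b hb)
    apply hab
    rw [← map_mul, ← map_mul, mul_comm]
end Burnside

theorem span_int (n : ℕ) (hn : n.Prime) (H : Subgroup (SL n ℤ))
    (hel : ∃ h ∈ H, Irreducible (matQ h).charpoly) (hnc : ∃ a ∈ H, ∃ b ∈ H, a * b ≠ b * a) :
    ∃ d : ℤ, d ≠ 0 ∧ ∀ M : Matrix (Fin n) (Fin n) ℤ,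
      d • M ∈ Submodule.span ℤ ((fun g : SL n ℤ => (g : Matrix (Fin n) (Fin n) ℤ)) '' H) := by
  classical
  obtain ⟨h, hH, hirr⟩ := hel
  let Q : SL n ℤ →* Matrix (Fin n) (Fin n) ℚ :=
    { toFun := matQ
      map_one' := by simp [matQ]
      map_mul' := by intro a b; simp [matQ, Matrix.map_mul_intCast] }
  let e := Matrix.toLinAlgEquiv' (R := ℚ) (n := Fin n)
  have hQinj : ∀ a b, Q a = Q b → a = b := by
    intro a b hab
    apply Subtype.ext
    exact Matrix.map_injective (Int.cast_injective (α := ℚ)) hab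
  let A : Subalgebra ℚ (Matrix (Fin n) (Fin n) ℚ) :=
    Algebra.adjoin ℚ ((Submonoid.map Q H.toSubmonoid : Submonoid _) : Set (Matrix (Fin n) (Fin n) ℚ))
  have hQA : ∀ a ∈ H, Q a ∈ A := fun a ha => Algebra.subset_adjoin ⟨a, ha, rfl⟩
  have hA : A.map e.toAlgHom = ⊤ := by
    refine burnside_prime (by simpa using hn) (e (Q h)) ?_ _ ⟨Q h, hQA h hH, rfl⟩ ?_
    · have : (e (Q h)).charpoly = (matQ h).charpoly := by
        exact Matrix.charpoly_toLin' (matQ h)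
      rw [this]; exact hirr
    · obtain ⟨a, ha, b, hb, hab⟩ := hnc
      refine ⟨e (Q a), ⟨Q a, hQA a ha, rfl⟩, e (Q b), ⟨Q b, hQA b hb, rfl⟩, fun hh => hab ?_⟩
      have h1 : e (Q a * Q b) = e (Q b * Q a) := by rw [map_mul, map_mul]; exact hh
      have h2 := e.injective h1
      rw [← map_mul, ← map_mul] at h2
      exact hQinj _ _ h2
  have hA2 : A = ⊤ := by
    rw [eq_top_iff]
    intro x _
    have : e x ∈ A.map e.toAlgHom := by rw [hA]; trivial
    obtain ⟨y, hy, hxy⟩ := this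
    rw [← e.injective hxy]
    exact hy
  have hspan : ∀ M : Matrix (Fin n) (Fin n) ℚ, M ∈ Submodule.span ℚ (matQ '' (H : Set (SL n ℤ))) := by
    intro M
    have : M ∈ A.toSubmodule := by rw [hA2]; trivial
    rw [Algebra.adjoin_eq_span, Submonoid.closure_eq] at this
    exact this
  set S := (fun g : SL n ℤ => (g : Matrix (Fin n) (Fin n) ℤ)) '' (H : Set (SL n ℤ)) with hS
  have hclear : ∀ M : Matrix (Fin n) (Fin n) ℚ, ∃ d : ℤ, d ≠ 0 ∧ ∃ N ∈ Submodule.span ℤ S,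
      N.map ((↑) : ℤ → ℚ) = (d : ℚ) • M := by
    intro M
    induction hspan M using Submodule.span_induction with
    | mem x hx =>
      obtain ⟨g, hg, rfl⟩ := hx
      exact ⟨1, one_ne_zero, g, Submodule.subset_span ⟨g, hg, rfl⟩, by simp [matQ]⟩
    | zero => exact ⟨1, one_ne_zero, 0, Submodule.zero_mem _, by ext; simp⟩
    | add x y _ _ hx hy =>
      obtain ⟨d, hd, N, hN, h1⟩ := hx
      obtain ⟨d', hd', N', hN', h1'⟩ := hy
      refine ⟨d * d', mul_ne_zero hd hd', d' • N + d • N',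
        Submodule.add_mem _ (Submodule.smul_mem _ _ hN) (Submodule.smul_mem _ _ hN'), ?_⟩
      ext i j
      have e1 := congrFun (congrFun h1 i) j
      have e2 := congrFun (congrFun h1' i) j
      simp only [Matrix.map_apply, Matrix.smul_apply, Matrix.add_apply, smul_eq_mul, Int.cast_mul, Int.cast_add, Int.cast_natCast] at e1 e2 ⊢
      rw [e1, e2]; ring
    | smul a x _ hx =>
      obtain ⟨d, hd, N, hN, h1⟩ := hx
      refine ⟨d * a.den, mul_ne_zero hd (by exact_mod_cast a.den_ne_zero), a.num • N,
        Submodule.smul_mem _ _ hN, ?_⟩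
      ext i j
      have e1 := congrFun (congrFun h1 i) j
      simp only [Matrix.map_apply, Matrix.smul_apply, Matrix.add_apply, smul_eq_mul, Int.cast_mul, Int.cast_add, Int.cast_natCast] at e1 ⊢
      rw [e1]
      have := Rat.mul_den_eq_num a
      rw [← this]; ring
  choose d hd N hN hdN using fun ij : Fin n × Fin n => hclear (Matrix.single ij.1 ij.2 1)
  refine ⟨∏ ij, d ij, Finset.prod_ne_zero_iff.mpr fun ij _ => hd ij, fun M => ?_⟩
  have hbase : ∀ ij, (d ij) • (Matrix.single ij.1 ij.2 (1 : ℤ) : Matrix (Fin n) (Fin n) ℤ) = N ij := by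
    intro ij
    apply Matrix.map_injective (Int.cast_injective (α := ℚ))
    refine Eq.trans ?_ (hdN ij).symm
    ext i j
    simp only [Matrix.map_apply, Matrix.smul_apply, Matrix.single_apply, smul_eq_mul]
    split_ifs <;> simp
  rw [Matrix.matrix_eq_sum_single M, Finset.smul_sum]
  refine Submodule.sum_mem _ fun i _ => ?_
  rw [Finset.smul_sum]
  refine Submodule.sum_mem _ fun j _ => ?_
  have : Matrix.single i j (M i j) = M i j • Matrix.single i j (1 : ℤ) := by simp
  rw [this, smul_comm]
  refine Submodule.smul_mem _ _ ?_
  rw [← Finset.prod_erase_mul _ _ (Finset.mem_univ (i, j)), mul_smul, hbase (i, j)]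
  exact Submodule.smul_mem _ _ (hN _)

theorem span_mod (n : ℕ) (d : ℤ) (S : Set (Matrix (Fin n) (Fin n) ℤ))
    (hd : ∀ M : Matrix (Fin n) (Fin n) ℤ, d • M ∈ Submodule.span ℤ S)
    (k : Type*) [Field k] (hk : (d : k) ≠ 0) :
    Submodule.span k ((fun M : Matrix (Fin n) (Fin n) ℤ => M.map ((↑) : ℤ → k)) '' S) = ⊤ := by
  classical
  rw [eq_top_iff]
  rintro M -
  have hmap : ∀ N ∈ Submodule.span ℤ S, N.map ((↑) : ℤ → k) ∈
      Submodule.span k ((fun M : Matrix (Fin n) (Fin n) ℤ => M.map ((↑) : ℤ → k)) '' S) := by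
    intro N hN
    induction hN using Submodule.span_induction with
    | mem x hx => exact Submodule.subset_span ⟨x, hx, rfl⟩
    | zero => convert Submodule.zero_mem _; ext; simp
    | add x y _ _ hx hy => convert Submodule.add_mem _ hx hy; ext; simp
    | smul a x _ hx =>
      convert Submodule.smul_mem _ (a : k) hx
      ext i j
      simp only [Matrix.map_apply, Matrix.smul_apply, smul_eq_mul, Int.cast_mul]
  rw [Matrix.matrix_eq_sum_single M]
  refine Submodule.sum_mem _ fun i _ => Submodule.sum_mem _ fun j _ => ?_
  have h1 := Submodule.smul_mem _ ((d : k)⁻¹ * M i j) (hmap _ (hd (Matrix.single i j 1)))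
  convert h1 using 1
  ext a b
  simp only [Matrix.single_apply, Matrix.smul_apply, Matrix.map_apply, smul_eq_mul]
  split_ifs <;> field_simp <;> simp

open Polynomial in
theorem roots_mod (n : ℕ) (hn : n.Prime) (hodd : Odd n) (f : ℤ[X]) (hf : Irreducible (f.map (Int.castRingHom ℚ)))
    (hm : f.Monic) (hd : f.natDegree = n) (h0 : f.coeff 0 = -1) :
    ∃ d : ℤ, d ≠ 0 ∧ ∀ p : ℕ, p.Prime → ¬ (p : ℤ) ∣ d → ∃ (k : Type) (_ : Field k) (_ : CharP k p)
      (μ : Fin n → k), f.map (Int.castRingHom k) = ∏ i, (X - C (μ i)) ∧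
      ∀ i j k m, i ≠ j → μ i * μ m = μ j * μ k → i = k ∧ j = m := by
  classical
  obtain ⟨l, hl, hrat⟩ := galois_roots n hn hodd (f.map (Int.castRingHom ℚ)) hf (hm.map _)
    (by rw [hm.natDegree_map, hd]) (by rw [coeff_map, h0]; simp)
  let K := (f.map (Int.castRingHom ℚ)).SplittingField
  rw [Polynomial.map_map] at hl
  have hintg : ∀ i, IsIntegral ℤ (l i) := by
    intro i
    refine ⟨f, hm, ?_⟩
    have e : algebraMap ℤ K = (algebraMap ℚ K).comp (Int.castRingHom ℚ) := RingHom.ext_int _ _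
    rw [← eval_map, e, hl, eval_prod]
    exact Finset.prod_eq_zero (Finset.mem_univ i) (by simp)
  let R := integralClosure ℤ K
  let lR : Fin n → R := fun i => ⟨l i, hintg i⟩
  have hlR : f.map (algebraMap ℤ R) = ∏ i, (X - C (lR i)) := by
    apply Polynomial.map_injective (algebraMap R K) Subtype.val_injective
    rw [Polynomial.map_map, Polynomial.map_prod]
    have e : (algebraMap R K).comp (algebraMap ℤ R) = (algebraMap ℚ K).comp (Int.castRingHom ℚ) :=
      RingHom.ext_int _ _
    rw [e, hl]
    refine Finset.prod_congr rfl fun i _ => ?_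
    simp [lR]
  let T : Finset (Fin n × Fin n × Fin n × Fin n) :=
    Finset.univ.filter fun t => t.1 ≠ t.2.1 ∧ ¬ (t.1 = t.2.2.1 ∧ t.2.1 = t.2.2.2)
  let Δ : R := ∏ t ∈ T, (lR t.1 * lR t.2.2.2 - lR t.2.1 * lR t.2.2.1)
  have hΔ : Δ ≠ 0 := by
    refine Finset.prod_ne_zero_iff.mpr ?_
    rintro ⟨i, j, k, m⟩ ht h
    obtain ⟨-, h1, h2⟩ := Finset.mem_filter.mp ht
    exact h2 (hrat i j k m h1 (congrArg Subtype.val (sub_eq_zero.mp h)))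
  have hbot : (Ideal.span {Δ}).comap (algebraMap ℤ R) ≠ ⊥ :=
    Ideal.comap_ne_bot_of_integral_mem hΔ (Ideal.mem_span_singleton_self Δ)
      (Algebra.IsIntegral.isIntegral Δ)
  obtain ⟨d, hdmem, hd0⟩ := Submodule.exists_mem_ne_zero_of_ne_bot hbot
  refine ⟨d, hd0, fun p hp hpd => ?_⟩
  have hmax : (Ideal.span {(p : ℤ)}).IsMaximal :=
    PrincipalIdealRing.isMaximal_of_irreducible (Nat.prime_iff_prime_int.mp hp).irreducible
  obtain ⟨P, hP, hPp⟩ := Ideal.exists_ideal_over_maximal_of_isIntegral (S := R) (Ideal.span {(p : ℤ)}) (by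
    have : RingHom.ker (algebraMap ℤ R) = ⊥ := by
      rw [← RingHom.injective_iff_ker_eq_bot]
      exact RingHom.injective_int _
    rw [this]; exact bot_le)
  have hmem : ∀ z : ℤ, (Ideal.Quotient.mk P (algebraMap ℤ R z) = 0 ↔ (p : ℤ) ∣ z) := by
    intro z
    rw [Ideal.Quotient.eq_zero_iff_mem, ← Ideal.mem_comap, hPp, Ideal.mem_span_singleton]
  let q := Ideal.Quotient.mk P
  refine ⟨R ⧸ P, Ideal.Quotient.field P, ?_, fun i => q (lR i), ?_, ?_⟩
  · constructor
    intro x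
    have := hmem x
    rw [← Int.natCast_dvd_natCast, ← this]
    have e := map_natCast ((Ideal.Quotient.mk P).comp (algebraMap ℤ R)) x
    exact ⟨fun h => e.trans h, fun h => e.symm.trans h⟩
  · have := congrArg (Polynomial.map q) hlR
    rw [Polynomial.map_map, Polynomial.map_prod] at this
    have e : q.comp (algebraMap ℤ R) = Int.castRingHom (R ⧸ P) := RingHom.ext_int _ _
    rw [e] at this
    refine Eq.trans this (Finset.prod_congr rfl fun i _ => ?_)
    rw [Polynomial.map_sub, Polynomial.map_X, Polynomial.map_C]
  · intro i j k m hij hrel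
    by_contra hne
    apply hpd
    rw [← hmem]
    have hd' : algebraMap ℤ R d ∈ Ideal.span {Δ} := hdmem
    rw [Ideal.mem_span_singleton] at hd'
    have : q Δ = 0 := by
      show q (∏ t ∈ T, _) = 0
      rw [map_prod]
      refine Finset.prod_eq_zero (i := (i, j, k, m)) (Finset.mem_filter.mpr ⟨Finset.mem_univ _, hij, hne⟩) ?_
      rw [map_sub, map_mul, map_mul]
      exact sub_eq_zero.mpr hrel
    obtain ⟨c, hc⟩ := hd'
    rw [hc, map_mul]
    have h2 : (Ideal.Quotient.mk P) Δ = 0 := this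
    rw [h2, zero_mul]

section LieCore
variable {k : Type*} [Field k] {n : ℕ}

/-- Hadamard multiplication operator. -/
def hadOp (r : Fin n → Fin n → k) : Module.End k (Matrix (Fin n) (Fin n) k) where
  toFun X := Matrix.of fun a b => r a b * X a b
  map_add' X Y := by ext a b; simp [mul_add]
  map_smul' c X := by ext a b; simp [mul_left_comm]

open Polynomial in
lemma hadOp_aeval (r : Fin n → Fin n → k) (q : k[X]) (X : Matrix (Fin n) (Fin n) k) (a b : Fin n) :
    (aeval (hadOp r) q X) a b = q.eval (r a b) * X a b := by
  induction q using Polynomial.induction_on' with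
  | add p q hp hq => simp [hp, hq, add_mul]
  | monomial m c =>
    rw [aeval_monomial, eval_monomial, Module.End.mul_apply, Module.algebraMap_end_apply,
      Matrix.smul_apply, smul_eq_mul, mul_assoc]
    congr 1
    induction m with
    | zero => simp
    | succ m ih =>
      rw [pow_succ', Module.End.mul_apply]
      show r a b * _ = _
      rw [ih]; ring

open Polynomial in
lemma hadOp_mem (r : Fin n → Fin n → k) (L : Submodule k (Matrix (Fin n) (Fin n) k))
    (hL : ∀ X ∈ L, hadOp r X ∈ L) (q : k[X]) (X : Matrix (Fin n) (Fin n) k) (hX : X ∈ L) :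
    aeval (hadOp r) q X ∈ L := by
  induction q using Polynomial.induction_on' with
  | add p q hp hq => rw [map_add]; exact L.add_mem hp hq
  | monomial m c =>
    rw [aeval_monomial, Module.End.mul_apply, Module.algebraMap_end_apply]
    refine L.smul_mem _ ?_
    induction m with
    | zero => simpa
    | succ m ih =>
      rw [pow_succ', Module.End.mul_apply]
      exact hL _ ih

lemma single_mem_of_entry (r : Fin n → Fin n → k) (L : Submodule k (Matrix (Fin n) (Fin n) k))
    (hL : ∀ X ∈ L, hadOp r X ∈ L) (i j : Fin n)
    (hr : ∀ a b, r a b = r i j → a = i ∧ b = j)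
    (X : Matrix (Fin n) (Fin n) k) (hX : X ∈ L) (hij : X i j ≠ 0) : Matrix.single i j (1 : k) ∈ L := by
  classical
  let V : Finset k := (Finset.univ.image fun t : Fin n × Fin n => r t.1 t.2).erase (r i j)
  let q : Polynomial k := ∏ v ∈ V, (Polynomial.X - Polynomial.C v)
  have h1 := hadOp_mem r L hL q X hX
  have hq : q.eval (r i j) ≠ 0 := by
    rw [Polynomial.eval_prod, Finset.prod_ne_zero_iff]
    intro v hv
    simp only [Polynomial.eval_sub, Polynomial.eval_X, Polynomial.eval_C]
    exact sub_ne_zero.mpr (Finset.ne_of_mem_erase hv).symm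
  have h2 : Matrix.single i j (1 : k) = (q.eval (r i j) * X i j)⁻¹ • Polynomial.aeval (hadOp r) q X := by
    ext a b
    rw [Matrix.smul_apply, hadOp_aeval, Matrix.single_apply, smul_eq_mul]
    split_ifs with h
    · obtain ⟨rfl, rfl⟩ := h
      rw [inv_mul_cancel₀ (mul_ne_zero hq hij)]
    · have : q.eval (r a b) = 0 := by
        rw [Polynomial.eval_prod]
        refine Finset.prod_eq_zero (i := r a b) ?_ (by simp)
        refine Finset.mem_erase.mpr ⟨fun e => h ?_, Finset.mem_image.mpr ⟨(a, b), Finset.mem_univ _, rfl⟩⟩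
        obtain ⟨h1, h2⟩ := hr a b e
        exact ⟨h1.symm, h2.symm⟩
      rw [this]; ring
  rw [h2]
  exact L.smul_mem _ h1

/-- coordinate subspace -/
def coordSub (k : Type*) [Field k] {n : ℕ} (C : Finset (Fin n)) : Submodule k (Fin n → k) where
  carrier := {v | ∀ i, i ∉ C → v i = 0}
  zero_mem' := by intro i _; rfl
  add_mem' := by intro v w hv hw i hi; simp [hv i hi, hw i hi]
  smul_mem' := by intro c v hv i hi; simp [hv i hi]

lemma finrank_coordSub (C : Finset (Fin n)) : Module.finrank k (coordSub k C) = C.card := by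
  classical
  let e : coordSub k C ≃ₗ[k] (C → k) :=
    { toFun := fun v i => v.1 i
      map_add' := fun _ _ => rfl
      map_smul' := fun _ _ => rfl
      invFun := fun f => ⟨fun i => if h : i ∈ C then f ⟨i, h⟩ else 0, fun i hi => dif_neg hi⟩
      left_inv := by
        intro v
        apply Subtype.ext
        funext i
        by_cases h : i ∈ C
        · exact dif_pos h
        · exact (dif_neg h).trans (v.2 i h).symm
      right_inv := by
        intro f
        funext i
        exact dif_pos i.2 }
  rw [e.finrank_eq]
  simp

theorem lie_core (hn : n.Prime) (r : Fin n → Fin n → k)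
    (hr : ∀ i j a b, i ≠ j → r a b = r i j → a = i ∧ b = j)
    (L : Submodule k (Matrix (Fin n) (Fin n) k))
    (hrL : ∀ X ∈ L, hadOp r X ∈ L)
    (𝒢 : Subgroup (Matrix (Fin n) (Fin n) k)ˣ)
    (hconj : ∀ g ∈ 𝒢, ∀ X ∈ L, (g : Matrix (Fin n) (Fin n) k) * X * ((g⁻¹ : (Matrix (Fin n) (Fin n) k)ˣ) : Matrix (Fin n) (Fin n) k) ∈ L)
    (hlie : ∀ X ∈ L, ∀ Y ∈ L, X * Y - Y * X ∈ L)
    (S : Set (Matrix (Fin n) (Fin n) k)) (hS : Submodule.span k S = L)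
    (hnil : ∀ X ∈ S, IsNilpotent X) (hL0 : L ≠ ⊥)
    (hirr : ∀ W : Submodule k (Fin n → k), (∀ g ∈ 𝒢, ∀ w ∈ W, (g : Matrix (Fin n) (Fin n) k) *ᵥ w ∈ W) →
      W = ⊥ ∨ W = ⊤) (i j : Fin n) (hij : i ≠ j) : Matrix.single i j (1 : k) ∈ L := by
  classical
  have hpos := hn.pos
  have hent : ∀ i j, i ≠ j → ∀ X ∈ L, X i j ≠ 0 → Matrix.single i j (1 : k) ∈ L :=
    fun i j hij X hX h => single_mem_of_entry r L hrL i j (fun a b => hr i j a b hij) X hX h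
  let R : Fin n → Fin n → Prop := fun i j => i = j ∨ Matrix.single i j (1 : k) ∈ L
  have hRt : ∀ a b c, R a b → R b c → R a c := by
    rintro a b c (rfl | h1) (rfl | h2)
    · exact Or.inl rfl
    · exact Or.inr h2
    · exact Or.inr h1
    · by_cases hac : a = c
      · exact Or.inl hac
      · right
        have := hlie _ h1 _ h2
        rwa [Matrix.single_mul_single_same, Matrix.single_mul_single_of_ne (h := Ne.symm hac), sub_zero, mul_one] at this
  have hRX : ∀ a b, ∀ X ∈ L, X a b ≠ 0 → R a b := by
    intro a b X hX h
    by_cases hab : a = b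
    · exact Or.inl hab
    · exact Or.inr (hent a b hab X hX h)
  let D : Fin n → Finset (Fin n) := fun j => Finset.univ.filter fun i => R i j
  have hD : ∀ i j, i ∈ D j ↔ R i j := fun i j => by simp [D]
  obtain ⟨c, -, hc⟩ := Finset.exists_min_image Finset.univ (fun j => (D j).card) ⟨⟨0, hpos⟩, Finset.mem_univ _⟩
  have hcc : c ∈ D c := (hD _ _).mpr (Or.inl rfl)
  have hDc : ∀ i ∈ D c, D i = D c := by
    intro i hi
    apply Finset.eq_of_subset_of_card_le
    · intro x hx
      rw [hD] at hx hi ⊢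
      exact hRt _ _ _ hx hi
    · exact hc i (Finset.mem_univ _)
  set C := D c with hC
  have hCR : ∀ a ∈ C, ∀ b ∈ C, a ≠ b → Matrix.single a b (1 : k) ∈ L := by
    intro a ha b hb hab
    rw [← hDc b hb, hD] at ha
    exact ha.resolve_left hab
  let U := coordSub k C
  have hUL : ∀ X ∈ L, ∀ v ∈ U, X *ᵥ v ∈ U := by
    intro X hX v hv a ha
    rw [Matrix.mulVec, dotProduct]
    refine Finset.sum_eq_zero fun b _ => ?_
    by_cases hb : b ∈ C
    · have : X a b = 0 := by
        by_contra h
        apply ha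
        rw [← hDc b hb, hD]
        exact hRX a b X hX h
      rw [this, zero_mul]
    · rw [hv b hb, mul_zero]
  have hcpos : 0 < C.card := Finset.card_pos.mpr ⟨c, hcc⟩
  rcases Nat.lt_or_ge C.card 2 with hlt | hge
  · exfalso
    have hC1 : C = {c} := by
      have : C.card = 1 := by omega
      obtain ⟨x, hx⟩ := Finset.card_eq_one.mp this
      rw [hx] at hcc ⊢
      rw [Finset.mem_singleton.mp hcc]
    let W : Submodule k (Fin n → k) :=
      { carrier := {v | ∀ X ∈ L, X *ᵥ v = 0}
        zero_mem' := by intro X _; exact Matrix.mulVec_zero X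
        add_mem' := by
          intro v w hv hw X hX
          rw [Matrix.mulVec_add, hv X hX, hw X hX, add_zero]
        smul_mem' := by
          intro a v hv X hX
          rw [Matrix.mulVec_smul, hv X hX, smul_zero] }
    have hWg : ∀ g ∈ 𝒢, ∀ w ∈ W, (g : Matrix (Fin n) (Fin n) k) *ᵥ w ∈ W := by
      intro g hg w hw X hX
      have h1 := hconj g⁻¹ (𝒢.inv_mem hg) X hX
      rw [inv_inv] at h1
      have h2 := hw _ h1
      have h3 := congrArg (fun v => (g : Matrix (Fin n) (Fin n) k) *ᵥ v) h2
      simp only [Matrix.mulVec_zero, Matrix.mulVec_mulVec, ← mul_assoc, Units.mul_inv, one_mul] at h3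
      rw [Matrix.mulVec_mulVec]
      exact h3
    let e : Fin n → k := Pi.single c 1
    have heU : e ∈ U := by
      intro i hi
      have : i ≠ c := fun h => hi (h ▸ hcc)
      simp [e, this]
    have hUe : ∀ v ∈ U, v = v c • e := by
      intro v hv
      funext i
      by_cases h : i = c
      · subst h; simp [e]
      · rw [hv i (by rw [hC1]; simpa using h)]; simp [e, h]
    have heW : e ∈ W := by
      intro X hX
      rw [← hS] at hX
      induction hX using Submodule.span_induction with
      | mem x hx =>
        have hxL : x ∈ L := by rw [← hS]; exact Submodule.subset_span hx
        have h1 := hUe _ (hUL x hxL e heU)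
        set a := (x *ᵥ e) c
        obtain ⟨m, hm⟩ := hnil x hx
        have hpow : ∀ m : ℕ, (x ^ m) *ᵥ e = a ^ m • e := by
          intro m
          induction m with
          | zero => simp
          | succ m ih =>
            rw [pow_succ', ← Matrix.mulVec_mulVec, ih, Matrix.mulVec_smul, h1, smul_smul, pow_succ]
        have h2 := hpow m
        rw [hm, Matrix.zero_mulVec] at h2
        have h3 := congrFun h2 c
        simp [e] at h3
        have ha : a = 0 := by
          by_contra h
          exact pow_ne_zero m h h3.symm
        rw [h1, ha, zero_smul]
      | zero => simp
      | add x y _ _ hx hy => rw [Matrix.add_mulVec, hx, hy, add_zero]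
      | smul a x _ hx => rw [Matrix.smul_mulVec, hx, smul_zero]
    rcases hirr W hWg with h | h
    · rw [h, Submodule.mem_bot] at heW
      have := congrFun heW c
      simp [e] at this
    · apply hL0
      rw [eq_bot_iff]
      intro X hX
      rw [Submodule.mem_bot]
      apply Matrix.ext_of_mulVec_single
      intro i
      have : (Pi.single i 1 : Fin n → k) ∈ W := by rw [h]; trivial
      rw [this X hX, Matrix.zero_mulVec]
  · -- simple module case
    have hsimple : ∀ W : Submodule k (Fin n → k), (∀ X ∈ L, ∀ w ∈ W, X *ᵥ w ∈ W) →
        W ⊓ U = ⊥ ∨ U ≤ W := by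
      intro W hW
      by_cases hb : W ⊓ U = ⊥
      · exact Or.inl hb
      right
      obtain ⟨w, ⟨hwW, hwU⟩, hw0⟩ := Submodule.exists_mem_ne_zero_of_ne_bot hb
      obtain ⟨i, hi⟩ := Function.ne_iff.mp hw0
      have hiC : i ∈ C := by
        by_contra h
        exact hi (hwU i h)
      have hstep : ∀ a b, a ∈ C → b ∈ C → a ≠ b → ∀ v ∈ W, v b ≠ 0 → (Pi.single a 1 : Fin n → k) ∈ W := by
        intro a b ha hb hab v hv hvb
        have h1 := hW _ (hCR a ha b hb hab) v hv
        have h2 := W.smul_mem (v b)⁻¹ h1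
        convert h2 using 1
        funext x
        rw [Pi.smul_apply, Matrix.single_mulVec]
        by_cases hx : x = a
        · subst hx; simp [hvb]
        · simp [hx]
      have hother : ∀ a ∈ C, a ≠ i → (Pi.single a 1 : Fin n → k) ∈ W :=
        fun a ha hai => hstep a i ha hiC hai w hwW hi
      obtain ⟨b, hb, hbi⟩ := Finset.exists_mem_ne (by omega : 1 < C.card) i
      have hall : ∀ a ∈ C, (Pi.single a 1 : Fin n → k) ∈ W := by
        intro a ha
        by_cases hai : a = i
        · rw [hai]
          exact hstep i b hiC hb hbi.symm _ (hother b hb hbi) (by simp)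
        · exact hother a ha hai
      intro v hv
      rw [pi_eq_sum_univ' v]
      refine W.sum_mem fun a _ => ?_
      by_cases ha : a ∈ C
      · refine W.smul_mem _ ?_
        convert hall a ha using 1
      · rw [hv a ha, zero_smul]; exact W.zero_mem
    have hdvd : C.card ∣ n := by
      let P : ℕ → Prop := fun d => ∃ W : Submodule k (Fin n → k), (∀ X ∈ L, ∀ w ∈ W, X *ᵥ w ∈ W) ∧
        Module.finrank k W = d ∧ C.card ∣ d
      have hP0 : P 0 := ⟨⊥, by
        intro X _ w hw
        rw [Submodule.mem_bot] at hw ⊢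
        rw [hw, Matrix.mulVec_zero], finrank_bot _ _, dvd_zero _⟩
      have hPb : ∀ d, P d → d ≤ n := by
        rintro d ⟨W, -, rfl, -⟩
        simpa using Submodule.finrank_le W
      obtain ⟨W, hWL, hWd, hWc⟩ := Nat.findGreatest_spec (P := P) (Nat.zero_le n) hP0
      set d := Nat.findGreatest P n
      have htop : W = ⊤ := by
        have hgU : ∀ g ∈ 𝒢, ∀ u ∈ U, (g : Matrix (Fin n) (Fin n) k) *ᵥ u ∈ W := by
          intro g hg
          let T := Matrix.toLin' (g : Matrix (Fin n) (Fin n) k)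
          have hTinj : Function.Injective T := by
            intro v w h
            have h' : (g : Matrix (Fin n) (Fin n) k) *ᵥ v = (g : Matrix (Fin n) (Fin n) k) *ᵥ w := h
            have := congrArg (fun v => ((g⁻¹ : (Matrix (Fin n) (Fin n) k)ˣ) : Matrix (Fin n) (Fin n) k) *ᵥ v) h'
            simpa [Matrix.mulVec_mulVec] using this
          have hmove : ∀ X ∈ L, ∀ v, ∃ Y ∈ L, X *ᵥ ((g : Matrix (Fin n) (Fin n) k) *ᵥ v) =
              (g : Matrix (Fin n) (Fin n) k) *ᵥ (Y *ᵥ v) := by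
            intro X hX v
            refine ⟨_, hconj g⁻¹ (𝒢.inv_mem hg) X hX, ?_⟩
            simp only [inv_inv, Matrix.mulVec_mulVec, ← mul_assoc, Units.mul_inv, one_mul]
          rcases hsimple (W.comap T) (by
            intro X hX w hw
            have h1 := hconj g hg X hX
            have h2 := hWL _ h1 _ hw
            show T (X *ᵥ w) ∈ W
            have : T (X *ᵥ w) = ((g : Matrix (Fin n) (Fin n) k) * X * ((g⁻¹ : (Matrix (Fin n) (Fin n) k)ˣ) : Matrix (Fin n) (Fin n) k)) *ᵥ (T w) := by
              simp only [T, Matrix.toLin'_apply, Matrix.mulVec_mulVec, mul_assoc, Units.inv_mul, mul_one]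
            rw [this]
            exact h2) with h | h
          · exfalso
            have hdisj : W ⊓ U.map T = ⊥ := by
              rw [eq_bot_iff]
              rintro _ ⟨hx, u, hu, rfl⟩
              have : u ∈ W.comap T ⊓ U := ⟨hx, hu⟩
              rw [h, Submodule.mem_bot] at this
              rw [this, map_zero]; exact Submodule.zero_mem _
            have hfr : Module.finrank k (U.map T) = C.card := by
              rw [← finrank_coordSub (k := k) C]
              exact (Submodule.equivMapOfInjective T hTinj U).finrank_eq.symm
            have hsum := Submodule.finrank_sup_add_finrank_inf_eq W (U.map T)
            rw [hdisj, finrank_bot, hfr, hWd, add_zero] at hsum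
            have hnew : P (d + C.card) := by
              refine ⟨W ⊔ U.map T, ?_, hsum, Dvd.dvd.add hWc (dvd_refl _)⟩
              intro X hX w hw
              obtain ⟨a, ha, _, ⟨u, hu, rfl⟩, rfl⟩ := Submodule.mem_sup.mp hw
              rw [Matrix.mulVec_add]
              refine Submodule.add_mem_sup (hWL X hX a ha) ?_
              obtain ⟨Y, hY, hYe⟩ := hmove X hX u
              exact ⟨Y *ᵥ u, hUL Y hY u hu, hYe.symm⟩
            have := Nat.le_findGreatest (hPb _ hnew) hnew
            omega
          · intro u hu
            exact h hu
        let Z : Submodule k (Fin n → k) := ⨆ g : 𝒢, U.map (Matrix.toLin' ((g : (Matrix (Fin n) (Fin n) k)ˣ) : Matrix (Fin n) (Fin n) k))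
        have hZW : Z ≤ W := by
          refine iSup_le fun g => ?_
          rintro _ ⟨u, hu, rfl⟩
          exact hgU g g.2 u hu
        have hZ : Z = ⊥ ∨ Z = ⊤ := by
          apply hirr
          intro g hg w hw
          have : Z ≤ Z.comap (Matrix.toLin' (g : Matrix (Fin n) (Fin n) k)) := by
            refine iSup_le fun x => ?_
            rintro _ ⟨u, hu, rfl⟩
            have hle := le_iSup (fun g : 𝒢 => U.map (Matrix.toLin' ((g : (Matrix (Fin n) (Fin n) k)ˣ) : Matrix (Fin n) (Fin n) k))) (⟨g, hg⟩ * x)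
            apply hle
            refine ⟨u, hu, ?_⟩
            simp [Matrix.toLin'_apply, Matrix.mulVec_mulVec]
          exact this hw
        rcases hZ with h | h
        · exfalso
          have hle := le_iSup (fun g : 𝒢 => U.map (Matrix.toLin' ((g : (Matrix (Fin n) (Fin n) k)ˣ) : Matrix (Fin n) (Fin n) k))) 1
          have h1 : (Pi.single c 1 : Fin n → k) ∈ Z := by
            apply hle
            refine ⟨Pi.single c 1, ?_, ?_⟩
            · intro i hi
              have : i ≠ c := fun h => hi (h ▸ hcc)
              simp [this]
            · simp
          rw [h, Submodule.mem_bot] at h1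
          have := congrFun h1 c
          simp at this
        · rw [eq_top_iff, ← h]; exact hZW
      rw [htop, finrank_top] at hWd
      simp at hWd
      exact hWc.trans (dvd_of_eq hWd.symm)
    have hCn : C.card = n := by
      rcases (Nat.dvd_prime hn).mp hdvd with h | h
      · omega
      · exact h
    have hCu : C = Finset.univ := by
      rw [← Finset.card_eq_iff_eq_univ, hCn]; simp
    exact hCR i (by rw [hCu]; simp) j (by rw [hCu]; simp) hij
end LieCore

section Expo
open Polynomial

lemma cast_injOn_range {k : Type*} [Field k] (p : ℕ) [CharP k p] (a b : ℕ) (ha : a < p) (hb : b < p)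
    (h : (a : k) = b) : a = b := by
  rw [CharP.natCast_eq_natCast k p] at h
  exact Nat.ModEq.eq_of_lt_of_lt h ha hb

lemma vdm {k : Type*} [Field k] (p : ℕ) [CharP k p] {V : Type*} [AddCommGroup V] [Module k V]
    (I : Submodule k V) (N : ℕ) (hN : N ≤ p) (w : ℕ → V)
    (h : ∀ c : ℕ, ∑ j ∈ Finset.range N, (c : k) ^ j • w j ∈ I) : ∀ j < N, w j ∈ I := by
  intro j hj
  rw [← Submodule.Quotient.mk_eq_zero I, ← Module.forall_dual_apply_eq_zero_iff k]
  intro φ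
  set q : k[X] := ∑ j ∈ Finset.range N, C (φ (I.mkQ (w j))) * X ^ j with hq
  have hdeg : q.degree < (N : ℕ) := by
    rw [hq]
    refine (Polynomial.degree_sum_le _ _).trans_lt ?_
    rw [Finset.sup_lt_iff (by exact WithBot.bot_lt_coe N)]
    intro b hb
    refine (Polynomial.degree_C_mul_X_pow_le _ _).trans_lt ?_
    exact_mod_cast Finset.mem_range.mp hb
  have hev : ∀ c : ℕ, q.eval (c : k) = 0 := by
    intro c
    have := h c
    rw [← Submodule.Quotient.mk_eq_zero I] at this
    have h2 := congrArg φ this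
    rw [map_zero] at h2
    rw [← h2, hq, Polynomial.eval_finsetSum]
    have : (Submodule.Quotient.mk (∑ j ∈ Finset.range N, (c : k) ^ j • w j) : V ⧸ I)
      = I.mkQ (∑ j ∈ Finset.range N, (c : k) ^ j • w j) := rfl
    rw [this, map_sum, map_sum]
    apply Finset.sum_congr rfl
    intro x _
    rw [Polynomial.eval_mul, Polynomial.eval_C, Polynomial.eval_pow, Polynomial.eval_X, map_smul,
      map_smul, smul_eq_mul, mul_comm]
  classical
  have hq0 : q = 0 := by
    apply Polynomial.eq_zero_of_natDegree_lt_card_of_eval_eq_zero' q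
      ((Finset.range p).image (fun c : ℕ => (c : k)))
    · intro x hx
      obtain ⟨c, _, rfl⟩ := Finset.mem_image.mp hx
      exact hev c
    · rw [Finset.card_image_of_injOn, Finset.card_range]
      · have : q.natDegree < N := by
          by_cases h0 : q = 0
          · rw [h0]; simp; omega
          · exact (Polynomial.natDegree_lt_iff_degree_lt h0).mpr hdeg
        omega
      · intro a ha b hb hab
        exact cast_injOn_range p a b (by simpa using ha) (by simpa using hb) hab
  have := congrArg (fun q => q.coeff j) hq0
  simp only [hq, Polynomial.finsetSum_coeff, Polynomial.coeff_C_mul, Polynomial.coeff_X_pow,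
    Polynomial.coeff_zero] at this
  rw [Finset.sum_eq_single j] at this
  · simpa using this
  · intro b _ hb; simp [hb.symm]
  · intro h; exact absurd (Finset.mem_range.mpr hj) h

variable {k : Type*} [Field k] {n : ℕ}

/-- coefficient matrix -/
def coeffMat (A : Matrix (Fin n) (Fin n) k[X]) (j : ℕ) : Matrix (Fin n) (Fin n) k :=
  A.map (fun q => q.coeff j)

lemma coeffMat_mem (p : ℕ) [CharP k p] (A : Matrix (Fin n) (Fin n) k[X]) (N : ℕ) (hN : N ≤ p)
    (hA : ∀ i j, (A i j).natDegree < N) (I : Submodule k (Matrix (Fin n) (Fin n) k))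
    (h : ∀ c : ℕ, A.map (fun q => q.eval (c : k)) ∈ I) (j : ℕ) : coeffMat A j ∈ I := by
  by_cases hj : j < N
  · refine vdm p I N hN (coeffMat A) ?_ j hj
    intro c
    convert h c using 1
    ext a b
    rw [Matrix.sum_apply]
    simp only [coeffMat, Matrix.smul_apply, Matrix.map_apply, smul_eq_mul]
    rw [Polynomial.eval_eq_sum_range' (hA a b)]
    exact Finset.sum_congr rfl fun x _ => mul_comm _ _
  · convert I.zero_mem using 1
    ext a b
    simp only [coeffMat, Matrix.map_apply, Matrix.zero_apply]
    exact Polynomial.coeff_eq_zero_of_natDegree_lt (by have := hA a b; omega)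

lemma coeffMat_mul_one (A B : Matrix (Fin n) (Fin n) k[X]) :
    coeffMat (A * B) 1 = coeffMat A 0 * coeffMat B 1 + coeffMat A 1 * coeffMat B 0 := by
  ext a b
  simp only [coeffMat, Matrix.map_apply, Matrix.mul_apply, Matrix.add_apply,
    Polynomial.finsetSum_coeff, Polynomial.coeff_mul, ← Finset.sum_add_distrib]
  apply Finset.sum_congr rfl
  intro x _
  rw [Finset.Nat.antidiagonal_succ]
  simp

lemma coeffMat_mul_zero (A B : Matrix (Fin n) (Fin n) k[X]) :
    coeffMat (A * B) 0 = coeffMat A 0 * coeffMat B 0 := by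
  ext a b
  simp [coeffMat, Matrix.mul_apply, Polynomial.mul_coeff_zero, Polynomial.finsetSum_coeff]

/-- binomial polynomial -/
noncomputable def bpoly (k : Type*) [Field k] (m : ℕ) : k[X] :=
  C ((m.factorial : k)⁻¹) * descPochhammer k m

lemma bpoly_natDegree (m : ℕ) : (bpoly k m).natDegree ≤ m := by
  refine (Polynomial.natDegree_C_mul_le _ _).trans ?_
  rw [descPochhammer_natDegree]

lemma bpoly_eval (p : ℕ) [Fact p.Prime] [CharP k p] (m : ℕ) (hm : m < p) (c : ℕ) :
    (bpoly k m).eval (c : k) = (c.choose m : k) := by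
  rw [bpoly, Polynomial.eval_mul, Polynomial.eval_C, descPochhammer_eval_eq_descFactorial,
    Nat.descFactorial_eq_factorial_mul_choose, Nat.cast_mul, ← mul_assoc, inv_mul_cancel₀, one_mul]
  intro h
  rw [CharP.cast_eq_zero_iff k p, (Fact.out : p.Prime).dvd_factorial] at h
  omega

/-- the matrix polynomial `u^t` -/
noncomputable def Epoly (u : Matrix (Fin n) (Fin n) k) : Matrix (Fin n) (Fin n) k[X] :=
  ∑ m ∈ Finset.range n, bpoly k m • ((u - 1) ^ m).map C

lemma Epoly_natDegree (hn : 0 < n) (u : Matrix (Fin n) (Fin n) k) (i j : Fin n) :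
    (Epoly u i j).natDegree ≤ n - 1 := by
  rw [Epoly, Matrix.sum_apply]
  apply Polynomial.natDegree_sum_le_of_forall_le
  intro m hm
  simp only [Matrix.smul_apply, Matrix.map_apply, smul_eq_mul]
  refine (Polynomial.natDegree_mul_C_le _ _).trans ((bpoly_natDegree m).trans ?_)
  have := Finset.mem_range.mp hm
  omega

lemma nilp_pow (M : Matrix (Fin n) (Fin n) k) (hM : IsNilpotent M) : M ^ n = 0 := by
  have h := Matrix.isNilpotent_charpoly_sub_pow_of_isNilpotent hM
  rw [isNilpotent_iff_eq_zero, sub_eq_zero, Fintype.card_fin] at h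
  have := Matrix.aeval_self_charpoly M
  rwa [h, map_pow, Polynomial.aeval_X] at this

lemma unip_nilp (p : ℕ) [Fact p.Prime] [CharP k p] (u : Matrix (Fin n) (Fin n) k)
    (hu : u ^ p = 1) : (u - 1) ^ n = 0 := by
  apply nilp_pow
  rcases Nat.eq_zero_or_pos n with rfl | hn
  · exact ⟨1, Subsingleton.elim _ _⟩
  haveI : Nonempty (Fin n) := ⟨⟨0, hn⟩⟩
  refine ⟨p, ?_⟩
  rw [sub_pow_char_of_commute _ (Commute.one_right u), hu, one_pow, sub_self]

lemma Epoly_eval (p : ℕ) [Fact p.Prime] [CharP k p] (hnp : n ≤ p) (u : Matrix (Fin n) (Fin n) k)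
    (hu : u ^ p = 1) (c : ℕ) : (Epoly u).map (fun q => q.eval (c : k)) = u ^ c := by
  have hnil := unip_nilp p u hu
  have h1 : (Epoly u).map (fun q => q.eval (c : k))
      = ∑ m ∈ Finset.range n, (u - 1) ^ m * (c.choose m : Matrix (Fin n) (Fin n) k) := by
    ext a b
    rw [Matrix.map_apply, Epoly, Matrix.sum_apply, Matrix.sum_apply, Polynomial.eval_finsetSum]
    apply Finset.sum_congr rfl
    intro m hm
    rw [Matrix.smul_apply, smul_eq_mul, Polynomial.eval_mul, bpoly_eval p m
      (by have := Finset.mem_range.mp hm; omega), Matrix.map_apply, Polynomial.eval_C, ← nsmul_eq_mul', 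
      Matrix.smul_apply, nsmul_eq_mul]
  have h2 : u ^ c = ∑ m ∈ Finset.range (c + 1), (u - 1) ^ m * (c.choose m : Matrix (Fin n) (Fin n) k) := by
    conv_lhs => rw [← sub_add_cancel u 1]
    rw [(Commute.one_right (u - 1)).add_pow]
    simp
  rw [h1, h2]
  rcases le_total n (c + 1) with h | h
  · apply Finset.sum_subset (Finset.range_mono h)
    intro x _ hx
    have : n ≤ x := by simpa using hx
    rw [pow_eq_zero_of_le this hnil, zero_mul]
  · symm
    apply Finset.sum_subset (Finset.range_mono h)
    intro x _ hx
    have : c < x := by simp at hx; omega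
    rw [Nat.choose_eq_zero_of_lt this, Nat.cast_zero, mul_zero]

lemma Epoly_coeff_zero (p : ℕ) [Fact p.Prime] [CharP k p] (hnp : n ≤ p) (u : Matrix (Fin n) (Fin n) k)
    (hu : u ^ p = 1) : coeffMat (Epoly u) 0 = 1 := by
  have := Epoly_eval p hnp u hu 0
  rw [pow_zero] at this
  rw [← this]
  ext a b
  simp [coeffMat, Polynomial.coeff_zero_eq_eval_zero]

/-- truncated log of `u` -/
noncomputable def Nlog (u : Matrix (Fin n) (Fin n) k) : Matrix (Fin n) (Fin n) k := coeffMat (Epoly u) 1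

lemma Nlog_eq (u : Matrix (Fin n) (Fin n) k) :
    Nlog u = ∑ m ∈ Finset.range n, (bpoly k m).coeff 1 • (u - 1) ^ m := by
  ext a b
  rw [Nlog, coeffMat, Matrix.map_apply, Epoly, Matrix.sum_apply, Matrix.sum_apply,
    Polynomial.finsetSum_coeff]
  apply Finset.sum_congr rfl
  intro m _
  simp [Polynomial.coeff_mul_C]

lemma Nlog_conj (u g g' : Matrix (Fin n) (Fin n) k) (hg : g' * g = 1) :
    Nlog (g * u * g') = g * Nlog u * g' := by
  have hg2 : g * g' = 1 := mul_eq_one_comm.mp hg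
  have h1 : g * u * g' - 1 = g * (u - 1) * g' := by
    rw [mul_sub, sub_mul, mul_one, hg2]
  have h2 : ∀ m : ℕ, (g * (u - 1) * g') ^ m = g * (u - 1) ^ m * g' := by
    intro m
    induction m with
    | zero => simp [hg2]
    | succ m ih =>
      rw [pow_succ, ih, pow_succ]
      calc g * (u - 1) ^ m * g' * (g * (u - 1) * g') = g * (u - 1) ^ m * (g' * g) * (u - 1) * g' := by
            simp only [mul_assoc]
        _ = _ := by rw [hg]; simp only [mul_assoc, mul_one, one_mul]
  rw [Nlog_eq, Nlog_eq, Finset.mul_sum, Finset.sum_mul]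
  apply Finset.sum_congr rfl
  intro m _
  rw [h1, h2]
  simp

lemma Nlog_factor (hn : 2 ≤ n) (u : Matrix (Fin n) (Fin n) k) :
    ∃ q : k[X], Nlog u = (u - 1) * (1 + (u - 1) * aeval (u - 1) q) := by
  refine ⟨∑ m ∈ Finset.range (n - 2), C ((bpoly k (m + 2)).coeff 1) * X ^ m, ?_⟩
  rw [Nlog_eq]
  obtain ⟨m, rfl⟩ : ∃ m, n = m + 2 := ⟨n - 2, by omega⟩
  rw [Finset.sum_range_succ', Finset.sum_range_succ']
  have h0 : (bpoly k 0).coeff 1 = 0 := by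
    simp [bpoly, Polynomial.coeff_one]
  have h1 : (bpoly k 1).coeff 1 = 1 := by
    simp [bpoly]
  simp only [zero_add, h0, h1, zero_smul, add_zero, one_smul, pow_one, Nat.add_sub_cancel, map_sum,
    map_mul, aeval_C, map_pow, aeval_X, mul_add, mul_one, Finset.mul_sum]
  refine (add_comm _ _).trans ?_
  congr 1
  apply Finset.sum_congr rfl
  intro x _
  rw [← Algebra.smul_def, mul_smul_comm, mul_smul_comm]
  congr 1
  rw [← mul_assoc, ← sq, ← pow_add]
  congr 1; omega

lemma Nlog_nilp (hn : 2 ≤ n) (p : ℕ) [Fact p.Prime] [CharP k p] (u : Matrix (Fin n) (Fin n) k)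
    (hu : u ^ p = 1) : IsNilpotent (Nlog u) := by
  obtain ⟨q, hq⟩ := Nlog_factor hn u
  have hc : Commute (u - 1) (aeval (u - 1) q) := by
    have := (Commute.all (X : k[X]) q).map (aeval (R := k) (u - 1))
    rwa [Polynomial.aeval_X] at this
  rw [hq]
  apply Commute.isNilpotent_mul_right
  · exact (Commute.one_right _).add_right ((Commute.refl _).mul_right hc)
  · exact ⟨n, unip_nilp p u hu⟩

lemma Nlog_ne_zero (hn : 2 ≤ n) (p : ℕ) [Fact p.Prime] [CharP k p] (u : Matrix (Fin n) (Fin n) k)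
    (hu : u ^ p = 1) (h1 : u ≠ 1) : Nlog u ≠ 0 := by
  obtain ⟨q, hq⟩ := Nlog_factor hn u
  have hc : Commute (u - 1) (aeval (u - 1) q) := by
    have := (Commute.all (X : k[X]) q).map (aeval (R := k) (u - 1))
    rwa [Polynomial.aeval_X] at this
  have hn : IsNilpotent ((u - 1) * aeval (u - 1) q) :=
    Commute.isNilpotent_mul_right hc ⟨n, unip_nilp p u hu⟩
  intro h
  rw [hq, hn.isUnit_one_add.mul_left_eq_zero, sub_eq_zero] at h
  exact h1 h

lemma Epoly_mul_natDegree (A B : Matrix (Fin n) (Fin n) k[X]) (a b : ℕ)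
    (hA : ∀ i j, (A i j).natDegree ≤ a) (hB : ∀ i j, (B i j).natDegree ≤ b) (i j : Fin n) :
    ((A * B) i j).natDegree ≤ a + b := by
  rw [Matrix.mul_apply]
  apply Polynomial.natDegree_sum_le_of_forall_le
  intro l _
  exact Polynomial.natDegree_mul_le_of_le (hA _ _) (hB _ _)

lemma evalMat_mul (A B : Matrix (Fin n) (Fin n) k[X]) (c : k) :
    (A * B).map (fun q => q.eval c) = A.map (fun q => q.eval c) * B.map (fun q => q.eval c) := by
  have := (Polynomial.evalRingHom c).mapMatrix.map_mul A B
  exact this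

lemma Nlog_bracket (hn : 2 ≤ n) (p : ℕ) [Fact p.Prime] [CharP k p] (hnp : 2 * n ≤ p)
    (u v : Matrix (Fin n) (Fin n) k) (huv : u * v = 1) (hu : u ^ p = 1) (hv : v ^ p = 1)
    (L : Submodule k (Matrix (Fin n) (Fin n) k)) (hL : ∀ X ∈ L, ∀ c : ℕ, u ^ c * X * v ^ c ∈ L)
    (X : Matrix (Fin n) (Fin n) k) (hX : X ∈ L) : Nlog u * X - X * Nlog u ∈ L := by
  have hinv : Nlog u + Nlog v = 0 := by
    have h1 : coeffMat (Epoly u * Epoly v - 1) 1 ∈ (⊥ : Submodule k (Matrix (Fin n) (Fin n) k)) := by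
      apply coeffMat_mem p _ (2 * n) hnp
      · intro i j
        rw [Matrix.sub_apply]
        refine (Polynomial.natDegree_sub_le _ _).trans_lt ?_
        rw [max_lt_iff]
        constructor
        · have := Epoly_mul_natDegree (Epoly u) (Epoly v) (n - 1) (n - 1)
            (Epoly_natDegree (by omega) u) (Epoly_natDegree (by omega) v) i j
          omega
        · rw [Matrix.one_apply]
          split_ifs <;> simp <;> omega
      · intro c
        rw [Submodule.mem_bot]
        have h2 := evalMat_mul (Epoly u) (Epoly v) (c : k)
        rw [Epoly_eval p (by omega) u hu, Epoly_eval p (by omega) v hv,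
          ← (show Commute u v from huv.trans (mul_eq_one_comm.mp huv).symm).mul_pow, huv, one_pow] at h2
        rw [show (Epoly u * Epoly v - 1).map (fun q => q.eval (c : k)) =
          (Epoly u * Epoly v).map (fun q => q.eval (c : k)) - (1 : Matrix (Fin n) (Fin n) k[X]).map (fun q => q.eval (c : k)) by
            ext; rw [Matrix.map_apply, Matrix.sub_apply, Matrix.sub_apply, Matrix.map_apply,
              Matrix.map_apply, Polynomial.eval_sub], h2]
        ext i j
        rw [Matrix.sub_apply, Matrix.map_apply, Matrix.one_apply, Matrix.one_apply]
        split_ifs <;> simp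
    rw [Submodule.mem_bot] at h1
    have h3 : coeffMat (Epoly u * Epoly v - 1) 1 = coeffMat (Epoly u * Epoly v) 1 := by
      ext i j
      simp [coeffMat, Matrix.one_apply]
      split_ifs <;> simp [Polynomial.coeff_one]
    rw [h3, coeffMat_mul_one, Epoly_coeff_zero p (by omega) u hu, Epoly_coeff_zero p (by omega) v hv,
      one_mul, mul_one] at h1
    rw [add_comm]; exact h1
  have h1 : coeffMat (Epoly u * X.map C * Epoly v) 1 ∈ L := by
    apply coeffMat_mem p _ (2 * n) hnp
    · intro i j
      have := Epoly_mul_natDegree (Epoly u * X.map C) (Epoly v) (n - 1) (n - 1)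
        (Epoly_mul_natDegree (Epoly u) (X.map C) (n - 1) 0
            (Epoly_natDegree (by omega) u) (by intro i j; simp)) (Epoly_natDegree (by omega) v) i j
      omega
    · intro c
      rw [evalMat_mul, evalMat_mul, Epoly_eval p (by omega) u hu, Epoly_eval p (by omega) v hv]
      convert hL X hX c using 3
      ext; simp
  have e0 : coeffMat (X.map C) 0 = X := by ext; simp [coeffMat]
  have e1 : coeffMat (X.map C) 1 = 0 := by ext; simp [coeffMat, Polynomial.coeff_C]
  rw [coeffMat_mul_one, coeffMat_mul_one, coeffMat_mul_zero, e0, e1,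
    Epoly_coeff_zero p (by omega) u hu, Epoly_coeff_zero p (by omega) v hv, mul_zero, zero_add, one_mul,
      mul_one] at h1
  have h4 : Nlog v = - Nlog u := by rw [eq_neg_iff_add_eq_zero, add_comm]; exact hinv
  change X * Nlog v + Nlog u * X ∈ L at h1
  rw [h4, mul_neg, neg_add_eq_sub] at h1
  exact h1
end Expo

section LieG
open Polynomial
variable {k : Type*} [Field k] {n : ℕ}

lemma exists_diag (M : Matrix (Fin n) (Fin n) k) (μ : Fin n → k) (hμ : Function.Injective μ)
    (hM : M.charpoly = ∏ i, (X - C (μ i))) :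
    ∃ P : (Matrix (Fin n) (Fin n) k)ˣ, M * (P : Matrix (Fin n) (Fin n) k) = P * diagonal μ := by
  have h1 : ∀ i, ∃ v : Fin n → k, v ≠ 0 ∧ M *ᵥ v = μ i • v := by
    intro i
    have h2 : (Matrix.scalar (Fin n) (μ i) - M).det = 0 := by
      rw [← Matrix.eval_charpoly, hM, Polynomial.eval_prod]
      apply Finset.prod_eq_zero (Finset.mem_univ i)
      simp
    obtain ⟨v, hv, h3⟩ := Matrix.exists_mulVec_eq_zero_iff.mpr h2
    refine ⟨v, hv, ?_⟩
    rw [Matrix.sub_mulVec, sub_eq_zero] at h3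
    rw [← h3]
    ext a
    simp [Matrix.scalar_apply, Matrix.mulVec_diagonal]
  choose v hv0 hv using h1
  have hli : LinearIndependent k v := by
    apply Module.End.eigenvectors_linearIndependent' (Matrix.toLin' M) μ hμ v
    intro i
    rw [Module.End.hasEigenvector_iff, Module.End.mem_eigenspace_iff]
    exact ⟨by rw [Matrix.toLin'_apply, hv], hv0 i⟩
  have hu : IsUnit (Matrix.of fun a b => v b a) := by
    rw [← Matrix.linearIndependent_cols_iff_isUnit]
    exact hli
  obtain ⟨P, hP⟩ := hu
  refine ⟨P, ?_⟩
  rw [hP]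
  ext a b
  rw [Matrix.mul_diagonal]
  have := congrFun (hv b) a
  simp only [Matrix.mulVec, dotProduct, Pi.smul_apply, smul_eq_mul] at this
  simp only [Matrix.mul_apply, Matrix.of_apply]
  rw [this, mul_comm]

/-- the Lie algebra attached to a group -/
noncomputable def LieG (p : ℕ) (𝒢 : Subgroup (Matrix (Fin n) (Fin n) k)ˣ) :
    Submodule k (Matrix (Fin n) (Fin n) k) :=
  Submodule.span k {X | ∃ u ∈ 𝒢, u ^ p = 1 ∧ Nlog (u : Matrix (Fin n) (Fin n) k) = X}

lemma LieG_conj (p : ℕ) (𝒢 : Subgroup (Matrix (Fin n) (Fin n) k)ˣ)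
    (g : (Matrix (Fin n) (Fin n) k)ˣ) (ℋ : Subgroup (Matrix (Fin n) (Fin n) k)ˣ)
    (hg : ∀ u ∈ 𝒢, g * u * g⁻¹ ∈ ℋ)
    (X : Matrix (Fin n) (Fin n) k) (hX : X ∈ LieG p 𝒢) :
    (g : Matrix (Fin n) (Fin n) k) * X * ((g⁻¹ : (Matrix (Fin n) (Fin n) k)ˣ) : Matrix (Fin n) (Fin n) k) ∈ LieG p ℋ := by
  induction hX using Submodule.span_induction with
  | mem x hx =>
    obtain ⟨u, hu, hup, rfl⟩ := hx
    apply Submodule.subset_span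
    refine ⟨g * u * g⁻¹, hg u hu, ?_, ?_⟩
    · rw [conj_pow, hup]; simp
    · rw [← Nlog_conj]
      · simp
      · simp
  | zero => simp
  | add x y _ _ hx hy => rw [mul_add, add_mul]; exact Submodule.add_mem _ hx hy
  | smul a x _ hx => rw [mul_smul_comm, smul_mul_assoc]; exact Submodule.smul_mem _ _ hx

lemma LieG_lie (hn : 2 ≤ n) (p : ℕ) [Fact p.Prime] [CharP k p] (hnp : 2 * n ≤ p)
    (𝒢 : Subgroup (Matrix (Fin n) (Fin n) k)ˣ)
    (X : Matrix (Fin n) (Fin n) k) (hX : X ∈ LieG p 𝒢)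
    (Y : Matrix (Fin n) (Fin n) k) (hY : Y ∈ LieG p 𝒢) : X * Y - Y * X ∈ LieG p 𝒢 := by
  induction hX using Submodule.span_induction with
  | mem x hx =>
    obtain ⟨u, hu, hup, rfl⟩ := hx
    apply Nlog_bracket hn p hnp u ((u⁻¹ : (Matrix (Fin n) (Fin n) k)ˣ) : Matrix (Fin n) (Fin n) k)
    · simp
    · rw [← Units.val_pow_eq_pow_val, hup]; rfl
    · rw [← Units.val_pow_eq_pow_val, inv_pow, hup]; simp
    · intro Z hZ c
      have := LieG_conj p 𝒢 (u ^ c) 𝒢 (fun v hv =>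
        𝒢.mul_mem (𝒢.mul_mem (𝒢.pow_mem hu c) hv) (𝒢.inv_mem (𝒢.pow_mem hu c))) Z hZ
      rwa [← inv_pow, Units.val_pow_eq_pow_val, Units.val_pow_eq_pow_val] at this
    · exact hY
  | zero => simp
  | add x y _ _ hx hy =>
    have : (x + y) * Y - Y * (x + y) = (x * Y - Y * x) + (y * Y - Y * y) := by noncomm_ring
    rw [this]; exact Submodule.add_mem _ hx hy
  | smul a x _ hx =>
    have : (a • x) * Y - Y * (a • x) = a • (x * Y - Y * x) := by
      rw [smul_sub, smul_mul_assoc, mul_smul_comm]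
    rw [this]; exact Submodule.smul_mem _ _ hx

lemma trace_zero_mem (L : Submodule k (Matrix (Fin n) (Fin n) k)) (hn : 0 < n)
    (hlie : ∀ X ∈ L, ∀ Y ∈ L, X * Y - Y * X ∈ L)
    (h : ∀ i j : Fin n, i ≠ j → Matrix.single i j (1 : k) ∈ L)
    (X : Matrix (Fin n) (Fin n) k) (hX : X.trace = 0) : X ∈ L := by
  set z : Fin n := ⟨0, hn⟩
  have hd : ∀ i, Matrix.single i i (1 : k) - Matrix.single z z (1 : k) ∈ L := by
    intro i
    by_cases hi : i = z
    · rw [hi, sub_self]; exact L.zero_mem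
    · have := hlie _ (h i z hi) _ (h z i (Ne.symm hi))
      simpa using this
  have hs : ∀ (i j : Fin n) (c : k), Matrix.single i j c = c • Matrix.single i j (1 : k) := by
    intro i j c; simp
  have key : X = ∑ i, ∑ j, if i = j then X i j • (Matrix.single i j (1 : k) - Matrix.single z z (1 : k))
      else X i j • Matrix.single i j (1 : k) := by
    have h1 : ∀ i, (∑ j, if i = j then X i j • (Matrix.single i j (1 : k) - Matrix.single z z (1 : k))
      else X i j • Matrix.single i j (1 : k)) = (∑ j, Matrix.single i j (X i j)) - X i i • Matrix.single z z (1 : k) := by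
      intro i
      have : ∀ j, (if i = j then X i j • (Matrix.single i j (1 : k) - Matrix.single z z (1 : k))
        else X i j • Matrix.single i j (1 : k)) = Matrix.single i j (X i j) - (if i = j then X i i • Matrix.single z z (1 : k) else 0) := by
        intro j
        rw [hs i j (X i j)]
        split_ifs with hij
        · subst hij; rw [smul_sub]
        · rw [sub_zero]
      simp_rw [this, Finset.sum_sub_distrib, Finset.sum_ite_eq, Finset.mem_univ, if_true]
    simp_rw [h1, Finset.sum_sub_distrib, ← Finset.sum_smul]
    have h2 : ∑ i, X i i = 0 := hX
    rw [h2, zero_smul, sub_zero]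
    exact Matrix.matrix_eq_sum_single X
  rw [key]
  apply Submodule.sum_mem
  intro i _
  apply Submodule.sum_mem
  intro j _
  split_ifs with hij
  · subst hij; exact L.smul_mem _ (hd i)
  · exact L.smul_mem _ (h i j hij)

lemma LieG_diag (hn : n.Prime) (p : ℕ) [Fact p.Prime] [CharP k p] (hnp : 2 * n ≤ p)
    (𝒢 : Subgroup (Matrix (Fin n) (Fin n) k)ˣ)
    (hirr : ∀ W : Submodule k (Fin n → k),
      (∀ g ∈ 𝒢, ∀ w ∈ W, (g : Matrix (Fin n) (Fin n) k) *ᵥ w ∈ W) → W = ⊥ ∨ W = ⊤)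
    (μ : Fin n → k) (hμ : ∀ i j l m, i ≠ j → μ i * μ m = μ j * μ l → i = l ∧ j = m)
    (h : (Matrix (Fin n) (Fin n) k)ˣ) (hh : h ∈ 𝒢) (hd : (h : Matrix (Fin n) (Fin n) k) = diagonal μ)
    (u : (Matrix (Fin n) (Fin n) k)ˣ) (hu : u ∈ 𝒢) (hup : u ^ p = 1) (hu1 : u ≠ 1)
    (X : Matrix (Fin n) (Fin n) k) (hX : X.trace = 0) : X ∈ LieG p 𝒢 := by
  apply trace_zero_mem _ hn.pos (fun X hX Y hY => LieG_lie hn.two_le p hnp 𝒢 X hX Y hY) _ X hX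
  have hμ0 : ∀ i, μ i ≠ 0 := by
    have h1 : IsUnit (diagonal μ).det := by
      rw [← hd]; exact (Matrix.isUnit_iff_isUnit_det _).mp h.isUnit
    rw [det_diagonal, isUnit_iff_ne_zero, Finset.prod_ne_zero_iff] at h1
    exact fun i => h1 i (Finset.mem_univ i)
  have hinv : ((h⁻¹ : (Matrix (Fin n) (Fin n) k)ˣ) : Matrix (Fin n) (Fin n) k) = diagonal (fun i => (μ i)⁻¹) := by
    apply Units.inv_eq_of_mul_eq_one_right
    rw [hd, diagonal_mul_diagonal, ← diagonal_one]
    congr 1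
    ext i
    exact mul_inv_cancel₀ (hμ0 i)
  have hconj : ∀ g ∈ 𝒢, ∀ X ∈ LieG p 𝒢, (g : Matrix (Fin n) (Fin n) k) * X * ((g⁻¹ : (Matrix (Fin n) (Fin n) k)ˣ) : Matrix (Fin n) (Fin n) k) ∈ LieG p 𝒢 := by
    intro g hg X hX
    exact LieG_conj p 𝒢 g 𝒢 (fun v hv => 𝒢.mul_mem (𝒢.mul_mem hg hv) (𝒢.inv_mem hg)) X hX
  apply lie_core hn (fun a b => μ a * (μ b)⁻¹) _ (LieG p 𝒢) _ 𝒢 hconj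
    (fun X hX Y hY => LieG_lie hn.two_le p hnp 𝒢 X hX Y hY) _ rfl _ _ hirr
  · intro i j a b hij h1
    rw [← div_eq_mul_inv, ← div_eq_mul_inv, div_eq_div_iff (hμ0 b) (hμ0 j)] at h1
    have := hμ i j a b hij (by rw [← h1, mul_comm])
    exact ⟨this.1.symm, this.2.symm⟩
  · intro X hX
    have := hconj h hh X hX
    rw [hinv, hd] at this
    convert this using 1
    ext a b
    rw [Matrix.mul_diagonal, Matrix.diagonal_mul]
    show μ a * (μ b)⁻¹ * X a b = _
    ring
  · rintro X ⟨v, hv, hvp, rfl⟩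
    apply Nlog_nilp hn.two_le p
    rw [← Units.val_pow_eq_pow_val, hvp]; rfl
  · intro h0
    have : Nlog (u : Matrix (Fin n) (Fin n) k) ∈ LieG p 𝒢 := Submodule.subset_span ⟨u, hu, hup, rfl⟩
    rw [h0, Submodule.mem_bot] at this
    refine Nlog_ne_zero hn.two_le p _ ?_ ?_ this
    · rw [← Units.val_pow_eq_pow_val, hup]; rfl
    · intro h1; exact hu1 (Units.ext h1)

theorem LieG_full (hn : n.Prime) (p : ℕ) [Fact p.Prime] [CharP k p] (hnp : 2 * n ≤ p)
    (𝒢 : Subgroup (Matrix (Fin n) (Fin n) k)ˣ)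
    (hirr : ∀ W : Submodule k (Fin n → k),
      (∀ g ∈ 𝒢, ∀ w ∈ W, (g : Matrix (Fin n) (Fin n) k) *ᵥ w ∈ W) → W = ⊥ ∨ W = ⊤)
    (μ : Fin n → k) (hμ : ∀ i j l m, i ≠ j → μ i * μ m = μ j * μ l → i = l ∧ j = m)
    (h : (Matrix (Fin n) (Fin n) k)ˣ) (hh : h ∈ 𝒢)
    (hd : (h : Matrix (Fin n) (Fin n) k).charpoly = ∏ i, (X - C (μ i)))
    (u : (Matrix (Fin n) (Fin n) k)ˣ) (hu : u ∈ 𝒢) (hup : u ^ p = 1) (hu1 : u ≠ 1)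
    (i j : Fin n) (hij : i ≠ j) : Matrix.single i j (1 : k) ∈ LieG p 𝒢 := by
  have hinj : Function.Injective μ := by
    intro a b hab
    by_contra hne
    have := hμ a b a b hne (by rw [hab])
    have h2 := hμ a b b a hne (by rw [mul_comm, hab])
    exact hne h2.1
  obtain ⟨P, hP⟩ := exists_diag (h : Matrix (Fin n) (Fin n) k) μ hinj hd
  set 𝒢' := 𝒢.map (MulAut.conj P⁻¹).toMonoidHom with h𝒢'
  have hmem : ∀ g ∈ 𝒢, P⁻¹ * g * P ∈ 𝒢' := by
    intro g hg
    exact ⟨g, hg, by simp⟩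
  have hdiag := LieG_diag hn p hnp 𝒢' (by
    intro W hW
    let e : (Fin n → k) ≃ₗ[k] (Fin n → k) :=
      LinearEquiv.ofLinearMap (Matrix.toLin' (P : Matrix (Fin n) (Fin n) k))
        (Matrix.toLin' ((P⁻¹ : (Matrix (Fin n) (Fin n) k)ˣ) : Matrix (Fin n) (Fin n) k))
        (by rw [← Matrix.toLin'_mul]; simp) (by rw [← Matrix.toLin'_mul]; simp)
    rcases hirr (W.map e.toLinearMap) (by
      rintro g hg _ ⟨w, hw, rfl⟩
      refine ⟨(↑(P⁻¹ * g * P) : Matrix (Fin n) (Fin n) k) *ᵥ w, hW _ (hmem g hg) w hw, ?_⟩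
      show (P : Matrix (Fin n) (Fin n) k) *ᵥ _ = (g : Matrix (Fin n) (Fin n) k) *ᵥ ((P : Matrix (Fin n) (Fin n) k) *ᵥ w)
      rw [Matrix.mulVec_mulVec, Matrix.mulVec_mulVec, ← Units.val_mul, ← Units.val_mul]
      congr 2
      group) with h1 | h1
    · left; exact (Submodule.map_eq_bot_iff (e := e) ).mp h1
    · right; exact (Submodule.map_eq_top_iff (e := e)).mp h1) μ hμ (P⁻¹ * h * P) (hmem h hh)
    (by rw [mul_assoc, Units.val_mul, Units.val_mul, hP, ← mul_assoc]; simp)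
    (P⁻¹ * u * P) (hmem u hu) (by
      have := conj_pow (i := p) (a := P⁻¹) (b := u)
      rw [inv_inv] at this
      rw [this, hup]; simp) (by
      intro h1
      apply hu1
      have : u = P * (P⁻¹ * u * P) * P⁻¹ := by group
      rw [this, h1]; simp)
    ((P⁻¹ : (Matrix (Fin n) (Fin n) k)ˣ) * Matrix.single i j (1 : k) * P) (by
      rw [Matrix.trace_mul_cycle]
      simp [Matrix.trace_single_eq_of_ne i j (1 : k) hij])
  have h2 := LieG_conj p 𝒢' P 𝒢 (by
    rintro _ ⟨g, hg, rfl⟩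
    convert hg using 1
    simp [mul_assoc]) _ hdiag
  convert h2 using 1
  simp [← mul_assoc]
end LieG

section Transv
variable {k : Type*} [Field k] {n : ℕ}

lemma sl_transvec_induction (Q : Matrix (Fin n) (Fin n) k → Prop) (h1 : Q 1)
    (ht : ∀ (i j : Fin n) (c : k), i ≠ j → Q (Matrix.transvection i j c))
    (hm : ∀ A B, Q A → Q B → Q (A * B)) (M : Matrix (Fin n) (Fin n) k) (hM : M.det = 1) : Q M := by
  have hpair : ∀ (i j : Fin n) (c : k), i ≠ j → c ≠ 0 →
      Q (diagonal (Function.update (Function.update (1 : Fin n → k) j c⁻¹) i c)) := by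
    intro i j c hij hc
    have : diagonal (Function.update (Function.update (1 : Fin n → k) j c⁻¹) i c)
        = (transvection i j c * transvection j i (-c⁻¹) * transvection i j c) *
          (transvection i j (-1) * transvection j i 1 * transvection i j (-1)) := by
      have hji := hij.symm
      simp only [transvection, mul_add, add_mul, mul_one, one_mul,
        single_mul_single_same, single_mul_single_of_ne _ _ _ _ hij, single_mul_single_of_ne _ _ _ _ hji,
        add_zero, zero_add, zero_mul]
      ext a b
      simp only [Matrix.add_apply, Matrix.single_apply, Matrix.one_apply, Matrix.diagonal_apply,
        Function.update_apply, Pi.one_apply, Matrix.zero_apply]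
      by_cases ha : a = i
      · subst ha
        by_cases hb : b = a
        · subst hb; simp [hij, hji]; field_simp; try ring
        · have hb' : a ≠ b := fun h => hb h.symm
          by_cases hb2 : j = b
          · subst hb2; simp [hij, hji, hb, hb']; field_simp; try ring
          · simp [hij, hji, hb, hb', hb2]
      · have ha' : i ≠ a := fun h => ha h.symm
        by_cases ha2 : a = j
        · subst ha2
          by_cases hb : b = a
          · subst hb; simp [hij, hji, ha, ha']; field_simp; try ring
          · have hb' : a ≠ b := fun h => hb h.symm
            by_cases hb2 : i = b
            · subst hb2; simp [hij, hji, hb, hb']; field_simp; try ring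
            · simp [hij, hji, hb, hb', hb2, ha']
        · have ha2' : j ≠ a := fun h => ha2 h.symm
          by_cases hb : a = b
          · subst hb; simp [ha, ha', ha2, ha2']
          · simp [ha, ha', ha2, ha2', hb]
    rw [this]
    exact hm _ _ (hm _ _ (hm _ _ (ht _ _ _ hij) (ht _ _ _ hij.symm)) (ht _ _ _ hij))
      (hm _ _ (hm _ _ (ht _ _ _ hij) (ht _ _ _ hij.symm)) (ht _ _ _ hij))
  apply diagonal_transvection_induction Q M
  · intro D hD
    rw [hM, det_diagonal] at hD
    rcases Nat.eq_zero_or_pos n with h0 | hpos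
    · subst h0
      convert h1
      exact Subsingleton.elim _ _
    have hD0 : ∀ i, D i ≠ 0 := by
      intro i hi
      rw [Finset.prod_eq_zero (Finset.mem_univ i) hi] at hD
      exact zero_ne_one hD
    set z : Fin n := ⟨0, hpos⟩
    -- general finset induction
    have key : ∀ S : Finset (Fin n), z ∉ S →
        Q (diagonal (fun i => if i = z then (∏ j ∈ S, D j)⁻¹ else if i ∈ S then D i else 1)) := by
      intro S
      induction S using Finset.induction_on with
      | empty =>
        intro _
        convert h1
        rw [← diagonal_one]
        congr 1
        ext i
        simp
      | insert a S ha ih =>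
        intro hz
        rw [Finset.mem_insert, not_or] at hz
        have := hm _ _ (ih hz.2) (hpair a z (D a) (Ne.symm hz.1) (hD0 a))
        rw [diagonal_mul_diagonal] at this
        convert this using 2
        ext i
        rw [Finset.prod_insert ha]
        have hza := hz.1
        by_cases hiz : i = z
        · subst hiz
          simp [hza, mul_comm]
        · by_cases hia : i = a
          · subst hia; simp [hiz, ha]
          · simp [hiz, hia, Function.update_apply]
    have := key (Finset.univ.erase z) (by simp)
    convert this using 2
    ext i
    by_cases hi : i = z
    · subst hi
      simp only [if_true]
      rw [← Finset.mul_prod_erase Finset.univ D (Finset.mem_univ z)] at hD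
      exact eq_inv_of_mul_eq_one_left hD
    · simp [hi]
  · rintro ⟨i, j, hij, c⟩
    exact ht i j c hij
  · exact hm
end Transv

section Density
open Polynomial
variable {k : Type*} [Field k] {n : ℕ}

/-- polynomials in matrix entries -/
abbrev MPoly (n : ℕ) (k : Type*) [Field k] := MvPolynomial (Fin n × Fin n) k

/-- evaluation of a polynomial at a matrix -/
noncomputable def mev (a : Matrix (Fin n) (Fin n) k) : MPoly n k →ₐ[k] k :=
  MvPolynomial.aeval (fun ij => a ij.1 ij.2)

/-- right translation -/
noncomputable def tau (a : Matrix (Fin n) (Fin n) k) : MPoly n k →ₐ[k] MPoly n k :=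
  MvPolynomial.aeval (fun ij => ∑ l, MvPolynomial.X (ij.1, l) * MvPolynomial.C (a l ij.2))

/-- right translation by a polynomial family -/
noncomputable def Phi (A : Matrix (Fin n) (Fin n) k[X]) : MPoly n k →ₐ[k] (MPoly n k)[X] :=
  MvPolynomial.aeval (fun ij => ∑ l, Polynomial.C (MvPolynomial.X (ij.1, l)) *
    (A l ij.2).map MvPolynomial.C)

lemma mev_tau (g a : Matrix (Fin n) (Fin n) k) (f : MPoly n k) :
    mev g (tau a f) = mev (g * a) f := by
  have : (mev g).comp (tau a) = mev (g * a) := by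
    apply MvPolynomial.algHom_ext
    intro ij
    simp [mev, tau, Matrix.mul_apply, MvPolynomial.algebraMap_eq]
  exact DFunLike.congr_fun this f

lemma tau_mul (a b : Matrix (Fin n) (Fin n) k) (f : MPoly n k) :
    tau (a * b) f = tau a (tau b f) := by
  have : tau (a * b) = (tau a).comp (tau b) := by
    apply MvPolynomial.algHom_ext
    intro ij
    simp only [tau, Matrix.mul_apply, AlgHom.comp_apply, MvPolynomial.aeval_X, map_sum, map_mul,
      MvPolynomial.algHom_C, MvPolynomial.algebraMap_eq, Finset.mul_sum, Finset.sum_mul]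
    rw [Finset.sum_comm]
    apply Finset.sum_congr rfl; intro x _
    apply Finset.sum_congr rfl; intro y _
    ring
  exact DFunLike.congr_fun this f

lemma tau_one (f : MPoly n k) : tau 1 f = f := by
  have : tau (1 : Matrix (Fin n) (Fin n) k) = AlgHom.id k _ := by
    apply MvPolynomial.algHom_ext
    intro ij
    simp [tau, Matrix.one_apply, apply_ite MvPolynomial.C]
  exact DFunLike.congr_fun this f

lemma Phi_eval (A : Matrix (Fin n) (Fin n) k[X]) (c : k) (f : MPoly n k) :
    (Phi A f).eval (MvPolynomial.C c) = tau (A.map (fun q => q.eval c)) f := by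
  have : ((Polynomial.aeval (R := MPoly n k) (MvPolynomial.C c : MPoly n k)).restrictScalars k).comp (Phi A)
      = tau (A.map (fun q => q.eval c)) := by
    apply MvPolynomial.algHom_ext
    intro ij
    simp only [Phi, tau, AlgHom.comp_apply, MvPolynomial.aeval_X, map_sum, map_mul,
      AlgHom.restrictScalars_apply, Polynomial.coe_aeval_eq_eval, Polynomial.eval_C, Matrix.map_apply]
    apply Finset.sum_congr rfl; intro x _
    rw [Polynomial.eval_map, Polynomial.eval₂_hom]
  have h := DFunLike.congr_fun this f
  simpa [Polynomial.coe_aeval_eq_eval] using h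

lemma Phi_natDegree (A : Matrix (Fin n) (Fin n) k[X]) (d : ℕ) (hA : ∀ i j, (A i j).natDegree ≤ d)
    (f : MPoly n k) : (Phi A f).natDegree ≤ f.totalDegree * d := by
  rw [Phi, MvPolynomial.aeval_def, MvPolynomial.eval₂_eq']
  apply Polynomial.natDegree_sum_le_of_forall_le
  intro s hs
  rw [show (algebraMap k (MPoly n k)[X]) (MvPolynomial.coeff s f) = Polynomial.C (MvPolynomial.C (MvPolynomial.coeff s f)) from rfl]
  refine (Polynomial.natDegree_C_mul_le _ _).trans ?_
  refine (Polynomial.natDegree_prod_le _ _).trans ?_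
  have h1 : s.sum (fun _ e => e) ≤ f.totalDegree := MvPolynomial.le_totalDegree hs
  rw [Finsupp.sum_fintype _ _ (by simp)] at h1
  refine le_trans ?_ (Nat.mul_le_mul_right d h1)
  rw [Finset.sum_mul]
  apply Finset.sum_le_sum
  intro ij _
  refine Polynomial.natDegree_pow_le.trans (Nat.mul_le_mul_left _ ?_)
  apply Polynomial.natDegree_sum_le_of_forall_le
  intro l _
  exact (Polynomial.natDegree_C_mul_le _ _).trans ((Polynomial.natDegree_map_le).trans (hA _ _))

lemma tau_totalDegree (a : Matrix (Fin n) (Fin n) k) (f : MPoly n k) :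
    (tau a f).totalDegree ≤ f.totalDegree := by
  rw [tau, MvPolynomial.aeval_def, MvPolynomial.eval₂_eq']
  apply MvPolynomial.totalDegree_finsetSum_le
  intro s hs
  have h1 : s.sum (fun _ e => e) ≤ f.totalDegree := MvPolynomial.le_totalDegree hs
  rw [Finsupp.sum_fintype _ _ (by simp)] at h1
  refine le_trans ?_ h1
  rw [MvPolynomial.algebraMap_eq]
  refine (MvPolynomial.totalDegree_mul _ _).trans ?_
  rw [MvPolynomial.totalDegree_C, zero_add]
  refine (MvPolynomial.totalDegree_finset_prod _ _).trans ?_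
  apply Finset.sum_le_sum
  intro ij _
  refine (MvPolynomial.totalDegree_pow _ _).trans ?_
  refine (Nat.mul_le_mul_left _ (m := 1) ?_).trans (by simp)
  apply MvPolynomial.totalDegree_finsetSum_le
  intro l _
  refine (MvPolynomial.totalDegree_mul _ _).trans ?_
  rw [MvPolynomial.totalDegree_C, MvPolynomial.totalDegree_X]

/-- invariant derivation -/
noncomputable def Dder (N : Matrix (Fin n) (Fin n) k) : Derivation k (MPoly n k) (MPoly n k) :=
  MvPolynomial.mkDerivation k (fun ij => ∑ l, MvPolynomial.X (ij.1, l) * MvPolynomial.C (N l ij.2))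

lemma Phi_coeff_zero (A : Matrix (Fin n) (Fin n) k[X]) (hA : coeffMat A 0 = 1) (f : MPoly n k) :
    (Phi A f).coeff 0 = f := by
  have h := Phi_eval A 0 f
  rw [map_zero, ← Polynomial.coeff_zero_eq_eval_zero] at h
  rw [h]
  have : (A.map fun q => q.eval 0) = 1 := by
    rw [← hA]; ext; simp [coeffMat, Polynomial.coeff_zero_eq_eval_zero]
  rw [this, tau_one]

lemma Phi_coeff_one (A : Matrix (Fin n) (Fin n) k[X]) (hA : coeffMat A 0 = 1) (f : MPoly n k) :
    (Phi A f).coeff 1 = Dder (coeffMat A 1) f := by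
  induction f using MvPolynomial.induction_on with
  | C a =>
    rw [← MvPolynomial.algebraMap_eq, AlgHom.commutes, Derivation.map_algebraMap]
    rw [show (algebraMap k (MPoly n k)[X]) a = Polynomial.C (MvPolynomial.C a) from rfl]
    simp [Polynomial.coeff_C]
  | add p q hp hq => simp [hp, hq]
  | mul_X p ij hp =>
    rw [map_mul, Polynomial.coeff_mul, Finset.Nat.antidiagonal_succ]
    simp only [Finset.Nat.antidiagonal_zero, Finset.map_singleton, Finset.sum_cons, Finset.sum_singleton,
      Function.Embedding.prodMap, Function.Embedding.coeFn_mk, Prod.map]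
    rw [Phi_coeff_zero A hA, Derivation.leibniz, smul_eq_mul, smul_eq_mul, ← hp]
    congr 1
    · congr 1
      simp [Phi, Dder, coeffMat, MvPolynomial.mkDerivation_X, Polynomial.coeff_map]
    · have := Phi_coeff_zero A hA (MvPolynomial.X ij)
      show (Phi A p).coeff 1 * (Phi A (MvPolynomial.X ij)).coeff 0 = _
      rw [this, mul_comm]

/-- vanishing polynomials of bounded degree -/
noncomputable def IG (D : ℕ) (𝒢 : Subgroup (Matrix (Fin n) (Fin n) k)ˣ) : Submodule k (MPoly n k) where
  carrier := {f | f.totalDegree ≤ D ∧ ∀ g ∈ 𝒢, mev (g : Matrix (Fin n) (Fin n) k) f = 0}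
  zero_mem' := by simp
  add_mem' := by
    rintro f g ⟨hf, hf2⟩ ⟨hg, hg2⟩
    refine ⟨(MvPolynomial.totalDegree_add _ _).trans (max_le hf hg), ?_⟩
    intro x hx
    rw [map_add, hf2 x hx, hg2 x hx, add_zero]
  smul_mem' := by
    rintro c f ⟨hf, hf2⟩
    refine ⟨(MvPolynomial.totalDegree_smul_le _ _).trans hf, ?_⟩
    intro x hx
    rw [map_smul, hf2 x hx, smul_zero]

lemma IG_tau (D : ℕ) (𝒢 : Subgroup (Matrix (Fin n) (Fin n) k)ˣ) (f : MPoly n k) (hf : f ∈ IG D 𝒢)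
    (g : (Matrix (Fin n) (Fin n) k)ˣ) (hg : g ∈ 𝒢) : tau (g : Matrix (Fin n) (Fin n) k) f ∈ IG D 𝒢 := by
  refine ⟨(tau_totalDegree _ _).trans hf.1, ?_⟩
  intro x hx
  rw [mev_tau, ← Units.val_mul]
  exact hf.2 _ (𝒢.mul_mem hx hg)

lemma eval_as_sum (q : (MPoly n k)[X]) (N : ℕ) (hN : q.natDegree < N) (c : k) :
    q.eval (MvPolynomial.C c) = ∑ j ∈ Finset.range N, c ^ j • q.coeff j := by
  rw [Polynomial.eval_eq_sum_range' hN]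
  apply Finset.sum_congr rfl
  intro j _
  rw [← map_pow, MvPolynomial.smul_eq_C_mul, mul_comm]

lemma IG_Dder_Nlog (hn : 0 < n) (p : ℕ) [Fact p.Prime] [CharP k p] (hnp : n ≤ p)
    (D : ℕ) (hD : D * n < p) (𝒢 : Subgroup (Matrix (Fin n) (Fin n) k)ˣ)
    (u : (Matrix (Fin n) (Fin n) k)ˣ) (hu : u ∈ 𝒢) (hup : u ^ p = 1)
    (f : MPoly n k) (hf : f ∈ IG D 𝒢) : Dder (Nlog (u : Matrix (Fin n) (Fin n) k)) f ∈ IG D 𝒢 := by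
  have hup' : (u : Matrix (Fin n) (Fin n) k) ^ p = 1 := by
    rw [← Units.val_pow_eq_pow_val, hup]; rfl
  rw [Nlog, ← Phi_coeff_one _ (Epoly_coeff_zero p hnp _ hup')]
  refine vdm p (IG D 𝒢) p le_rfl (fun j => (Phi (Epoly (u : Matrix (Fin n) (Fin n) k)) f).coeff j) ?_ 1
    (Fact.out : p.Prime).one_lt
  intro c
  rw [← eval_as_sum _ p, Phi_eval, Epoly_eval p hnp _ hup', ← Units.val_pow_eq_pow_val]
  · exact IG_tau D 𝒢 f hf _ (𝒢.pow_mem hu c)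
  · refine (Phi_natDegree _ (n - 1) (Epoly_natDegree hn _) f).trans_lt ?_
    have h1 := hf.1
    have : f.totalDegree * (n - 1) ≤ D * n := Nat.mul_le_mul h1 (by omega)
    omega

lemma Dder_add (M N : Matrix (Fin n) (Fin n) k) : Dder (M + N) = Dder M + Dder N := by
  apply MvPolynomial.derivation_ext
  intro ij
  simp [Dder, MvPolynomial.mkDerivation_X, mul_add, Finset.sum_add_distrib]

lemma Dder_smul (c : k) (N : Matrix (Fin n) (Fin n) k) : Dder (c • N) = c • Dder N := by
  apply MvPolynomial.derivation_ext
  intro ij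
  simp only [Dder, MvPolynomial.mkDerivation_X, Derivation.smul_apply, Matrix.smul_apply, smul_eq_mul,
    Finset.smul_sum, map_mul, MvPolynomial.smul_eq_C_mul]
  apply Finset.sum_congr rfl; intro x _; ring

lemma IG_Dder (hn : 0 < n) (p : ℕ) [Fact p.Prime] [CharP k p] (hnp : n ≤ p)
    (D : ℕ) (hD : D * n < p) (𝒢 : Subgroup (Matrix (Fin n) (Fin n) k)ˣ)
    (X : Matrix (Fin n) (Fin n) k) (hX : X ∈ LieG p 𝒢)
    (f : MPoly n k) (hf : f ∈ IG D 𝒢) : Dder X f ∈ IG D 𝒢 := by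
  induction hX using Submodule.span_induction with
  | mem x hx =>
    obtain ⟨u, hu, hup, rfl⟩ := hx
    exact IG_Dder_Nlog hn p hnp D hD 𝒢 u hu hup f hf
  | zero =>
    have : Dder (0 : Matrix (Fin n) (Fin n) k) = 0 := by
      have := Dder_smul (0 : k) (0 : Matrix (Fin n) (Fin n) k)
      simpa using this
    rw [this]; exact Submodule.zero_mem _
  | add x y _ _ hx hy => rw [Dder_add]; exact Submodule.add_mem _ hx hy
  | smul a x _ hx => rw [Dder_smul]; exact Submodule.smul_mem _ _ hx

/-- one-parameter transvection -/
noncomputable def Tpoly (i j : Fin n) : Matrix (Fin n) (Fin n) k[X] := Matrix.transvection i j X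

lemma Phi_Tpoly_X (i j : Fin n) (ab : Fin n × Fin n) :
    Phi (Tpoly i j : Matrix (Fin n) (Fin n) k[X]) (MvPolynomial.X ab) =
      Polynomial.C (MvPolynomial.X ab) + if ab.2 = j then Polynomial.C (MvPolynomial.X (ab.1, i)) * X else 0 := by
  simp only [Phi, Tpoly, MvPolynomial.aeval_X, transvection, Matrix.add_apply, Matrix.one_apply,
    Matrix.single_apply, Polynomial.map_add, mul_add, Finset.sum_add_distrib]
  congr 1
  · rw [Finset.sum_eq_single ab.2]
    · simp
    · intro b _ hb; simp [hb]
    · simp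
  · rw [Finset.sum_eq_single i]
    · by_cases h : ab.2 = j
      · simp [h]
      · simp [h, Ne.symm h]
    · intro b _ hb; simp [Ne.symm hb]
    · simp

lemma derivative_Phi (i j : Fin n) (hij : i ≠ j) (f : MPoly n k) :
    derivative (Phi (Tpoly i j) f) = Phi (Tpoly i j) (Dder (Matrix.single i j 1) f) := by
  induction f using MvPolynomial.induction_on with
  | C a =>
    rw [← MvPolynomial.algebraMap_eq, AlgHom.commutes, Derivation.map_algebraMap]
    rw [show (algebraMap k (MPoly n k)[X]) a = Polynomial.C (MvPolynomial.C a) from rfl]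
    simp
  | add p q hp hq => simp [hp, hq]
  | mul_X p ab hp =>
    rw [map_mul, Polynomial.derivative_mul, Derivation.leibniz, smul_eq_mul, smul_eq_mul, hp,
      map_add, map_mul, map_mul]
    have h1 : derivative (Phi (Tpoly i j) (MvPolynomial.X ab : MPoly n k)) =
        Phi (Tpoly i j) (Dder (Matrix.single i j 1) (MvPolynomial.X ab)) := by
      have h2 : Dder (Matrix.single i j (1 : k)) (MvPolynomial.X ab) =
          if ab.2 = j then MvPolynomial.X (ab.1, i) else 0 := by
        rw [Dder, MvPolynomial.mkDerivation_X, Finset.sum_eq_single i]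
        · by_cases h : ab.2 = j
          · simp [h]
          · simp [h, Ne.symm h]
        · intro b _ hb; simp [Ne.symm hb, Matrix.single_apply]
        · simp
      rw [h2, Phi_Tpoly_X]
      split_ifs with h
      · rw [Phi_Tpoly_X]; simp [hij]
      · simp
    rw [h1]; ring

lemma IG_transvection (hn : 0 < n) (p : ℕ) [Fact p.Prime] [CharP k p] (hnp : n ≤ p)
    (D : ℕ) (hD : D * n < p) (𝒢 : Subgroup (Matrix (Fin n) (Fin n) k)ˣ)
    (i j : Fin n) (hij : i ≠ j) (hE : Matrix.single i j (1 : k) ∈ LieG p 𝒢)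
    (f : MPoly n k) (hf : f ∈ IG D 𝒢) (c : k) : tau (Matrix.transvection i j c) f ∈ IG D 𝒢 := by
  have hcoef : ∀ m < p, ∀ f ∈ IG D 𝒢, (Phi (Tpoly i j) f).coeff m ∈ IG D 𝒢 := by
    intro m
    induction m with
    | zero =>
      intro _ f hf
      rw [Phi_coeff_zero _ _ f]
      · exact hf
      · ext a b
        simp only [coeffMat, Tpoly, transvection, Matrix.map_apply, Matrix.add_apply, Matrix.one_apply,
          Matrix.single_apply]
        split_ifs <;> simp
    | succ m ih =>
      intro hm f hf
      have h1 := ih (by omega) _ (IG_Dder hn p hnp D hD 𝒢 _ hE f hf)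
      rw [← derivative_Phi i j hij, Polynomial.coeff_derivative] at h1
      have h0 : ((m : k) + 1) ≠ 0 := by
        intro h
        have : ((m + 1 : ℕ) : k) = 0 := by push_cast; exact h
        rw [CharP.cast_eq_zero_iff k p] at this
        exact absurd (Nat.le_of_dvd (by omega) this) (by omega)
      have h2 := (IG D 𝒢).smul_mem ((m : k) + 1)⁻¹ h1
      convert h2 using 1
      rw [mul_comm, show ((m : MPoly n k) + 1) = MvPolynomial.C ((m : k) + 1) by simp,
        ← MvPolynomial.smul_eq_C_mul, smul_smul, inv_mul_cancel₀ h0, one_smul]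
  have h1 : (Tpoly i j : Matrix (Fin n) (Fin n) k[X]).map (fun q => q.eval c) = Matrix.transvection i j c := by
    ext a b
    simp only [Tpoly, transvection, Matrix.map_apply, Matrix.add_apply, Matrix.one_apply,
          Matrix.single_apply]
    split_ifs <;> simp
  rw [← h1, ← Phi_eval, eval_as_sum _ p]
  · apply Submodule.sum_mem
    intro m hm
    exact Submodule.smul_mem _ _ (hcoef m (Finset.mem_range.mp hm) f hf)
  · refine (Phi_natDegree _ 1 ?_ f).trans_lt ?_
    · intro a b
      simp only [Tpoly, transvection, Matrix.add_apply, Matrix.one_apply, Matrix.single_apply]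
      refine (Polynomial.natDegree_add_le _ _).trans (max_le ?_ ?_)
      · split_ifs <;> simp
      · split_ifs <;> simp
    · have h1 := hf.1
      have : f.totalDegree * 1 ≤ D * n := Nat.mul_le_mul h1 hn
      omega

theorem IG_SL (hn : 0 < n) (p : ℕ) [Fact p.Prime] [CharP k p] (hnp : n ≤ p)
    (D : ℕ) (hD : D * n < p) (𝒢 : Subgroup (Matrix (Fin n) (Fin n) k)ˣ)
    (hE : ∀ i j : Fin n, i ≠ j → Matrix.single i j (1 : k) ∈ LieG p 𝒢)
    (f : MPoly n k) (hf : f ∈ IG D 𝒢) (M : Matrix (Fin n) (Fin n) k) (hM : M.det = 1) :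
    mev M f = 0 := by
  have h : ∀ f ∈ IG D 𝒢, tau M f ∈ IG D 𝒢 := by
    apply sl_transvec_induction (fun M => ∀ f ∈ IG D 𝒢, tau M f ∈ IG D 𝒢) _ _ _ M hM
    · intro f hf; rwa [tau_one]
    · intro i j c hij f hf
      exact IG_transvection hn p hnp D hD 𝒢 i j hij (hE i j hij) f hf c
    · intro A B hA hB f hf
      rw [tau_mul]; exact hA _ (hB _ hf)
  have := (h f hf).2 1 𝒢.one_mem
  rwa [mev_tau, Units.val_one, one_mul] at this
end Density

section Count
variable {k : Type*} [Field k] {n : ℕ}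

lemma det_add_single (a : Matrix (Fin n) (Fin n) k) (z : Fin n) (c : k) :
    (a + Matrix.single z z c).det = a.det + c * a.adjugate z z := by
  have : a + Matrix.single z z c = a.updateRow z (a z + c • Pi.single z 1) := by
    ext i j
    rw [Matrix.updateRow_apply]
    by_cases hi : i = z
    · subst hi
      by_cases hj : j = i
      · subst hj; simp
      · simp [hj, Ne.symm hj]
    · simp [hi, Ne.symm hi]
  rw [this, Matrix.det_updateRow_add, Matrix.det_updateRow_smul, Matrix.adjugate_apply,
    Matrix.updateRow_eq_self]

lemma vanish_SL [Infinite k] (z : Fin n) (f : MPoly n k)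
    (hf : ∀ M : Matrix (Fin n) (Fin n) k, M.det = 1 → mev M f = 0)
    (hz : ∀ a b : Matrix (Fin n) (Fin n) k, (∀ ij : Fin n × Fin n, ij ≠ (z, z) → a ij.1 ij.2 = b ij.1 ij.2) →
      mev a f = mev b f) : f = 0 := by
  set G : Matrix (Fin n) (Fin n) (MPoly n k) := Matrix.mvPolynomialX (Fin n) (Fin n) k
  have hG : ∀ a : Matrix (Fin n) (Fin n) k, mev a (G.adjugate z z) = a.adjugate z z := by
    intro a
    have h1 := (mev a).toRingHom.map_adjugate G
    have h2 : (mev a).toRingHom.mapMatrix G = a := by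
      ext i j
      simp [G, mev]
    rw [h2] at h1
    rw [← h1]
    rfl
  have hq : f * G.adjugate z z = 0 := by
    apply MvPolynomial.funext
    intro x
    set a : Matrix (Fin n) (Fin n) k := Matrix.of fun i j => x (i, j) with ha
    have hx : ∀ q : MPoly n k, MvPolynomial.eval x q = mev a q := by
      intro q
      rw [mev, MvPolynomial.aeval_eq_eval]
      rfl
    rw [map_zero, hx, map_mul, hG]
    by_cases h0 : a.adjugate z z = 0
    · rw [h0, mul_zero]
    · have h1 : mev a f = 0 := by
        rw [hz a (a + Matrix.single z z ((1 - a.det) / a.adjugate z z))]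
        · apply hf
          rw [det_add_single, div_mul_cancel₀ _ h0]
          ring
        · intro ij hij
          rw [Matrix.add_apply, Matrix.single_apply, if_neg, add_zero]
          rintro ⟨h1, h2⟩
          exact hij (Prod.ext h1.symm h2.symm)
      rw [h1, zero_mul]
  rcases mul_eq_zero.mp hq with h | h
  · exact h
  · exfalso
    have := hG 1
    rw [h, map_zero, Matrix.adjugate_one, Matrix.one_apply_eq] at this
    exact zero_ne_one this

/-- exponent vector -/
noncomputable def expo (z : Fin n) (e : ℕ) (s : {ij : Fin n × Fin n // ij ≠ (z, z)} → Fin (e + 1)) :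
    (Fin n × Fin n) →₀ ℕ :=
  Finsupp.equivFunOnFinite.symm (fun ij => if h : ij ≠ (z, z) then (s ⟨ij, h⟩ : ℕ) else 0)

lemma expo_inj (z : Fin n) (e : ℕ) : Function.Injective (expo z e) := by
  intro s t h
  ext ⟨ij, hij⟩
  have := DFunLike.congr_fun h ij
  simpa [expo, hij] using this

theorem card_bound [Infinite k] (hn : 0 < n) (p : ℕ) [Fact p.Prime] [CharP k p] (hnp : n ≤ p)
    (e : ℕ) (he : n * n * e * n < p) (𝒢 : Subgroup (Matrix (Fin n) (Fin n) k)ˣ) [Finite 𝒢]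
    (hE : ∀ i j : Fin n, i ≠ j → Matrix.single i j (1 : k) ∈ LieG p 𝒢) :
    (e + 1) ^ (n * n - 1) ≤ Nat.card 𝒢 := by
  classical
  have := Fintype.ofFinite 𝒢
  set z : Fin n := ⟨0, hn⟩
  let ι := {ij : Fin n × Fin n // ij ≠ (z, z)} → Fin (e + 1)
  let F : (ι → k) →ₗ[k] MPoly n k := Fintype.linearCombination k (fun s : ι => MvPolynomial.monomial (expo z e s) (1 : k))
  let T : (ι → k) →ₗ[k] (𝒢 → k) :=
    LinearMap.pi (fun g : 𝒢 => (mev ((g : (Matrix (Fin n) (Fin n) k)ˣ) : Matrix (Fin n) (Fin n) k)).toLinearMap ∘ₗ F)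
  have hF : ∀ c, F c = ∑ s : ι, MvPolynomial.monomial (expo z e s) (c s) := by
    intro c
    simp only [F, Fintype.linearCombination_apply, MvPolynomial.smul_monomial, smul_eq_mul, mul_one]
  have hinj : Function.Injective T := by
    rw [← LinearMap.ker_eq_bot, LinearMap.ker_eq_bot']
    intro c hc
    have hI : F c ∈ IG (n * n * e) 𝒢 := by
      constructor
      · rw [hF]
        apply MvPolynomial.totalDegree_finsetSum_le
        intro s _
        refine (MvPolynomial.totalDegree_monomial_le _ _).trans ?_
        show (expo z e s).sum (fun _ e => e) ≤ _
        rw [Finsupp.sum_fintype _ _ (by simp)]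
        refine (Finset.sum_le_card_nsmul _ _ e ?_).trans ?_
        · intro ij _
          simp only [expo, Finsupp.equivFunOnFinite_symm_apply_apply]
          split_ifs
          · omega
          · omega
        · simp
      · intro g hg
        exact congrFun hc ⟨g, hg⟩
    have h0 : F c = 0 := by
      apply vanish_SL z
      · intro M hM
        exact IG_SL hn p hnp (n * n * e) he 𝒢 hE (F c) hI M hM
      · intro a b hab
        rw [hF, map_sum, map_sum]
        apply Finset.sum_congr rfl
        intro s _
        simp only [mev, MvPolynomial.aeval_monomial]
        congr 1
        rw [Finsupp.prod_fintype _ _ (by simp), Finsupp.prod_fintype _ _ (by simp)]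
        apply Finset.prod_congr rfl
        intro ij _
        by_cases h : ij = (z, z)
        · subst h; simp [expo]
        · rw [hab ij h]
    funext s
    have h1 := congrArg (MvPolynomial.coeff (expo z e s)) h0
    rw [hF, MvPolynomial.coeff_sum, Finset.sum_eq_single s] at h1
    · simpa using h1
    · intro t _ ht
      rw [MvPolynomial.coeff_monomial, if_neg]
      intro h; exact ht (expo_inj z e h)
    · simp
  have := LinearMap.finrank_le_finrank_of_injective hinj
  rw [Module.finrank_fintype_fun_eq_card, Module.finrank_fintype_fun_eq_card, ← Nat.card_eq_fintype_card (α := 𝒢)] at this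
  refine le_trans (le_of_eq ?_) this
  simp [ι]
end Count

section Final
open Polynomial

lemma sl_card (n p : ℕ) [Fact p.Prime] (hn : 0 < n) :
    Nat.card (SL n (ZMod p)) * (p - 1) ≤ p ^ (n * n) := by
  have hp := (Fact.out : p.Prime)
  let z : Fin n := ⟨0, hn⟩
  let F : SL n (ZMod p) × (ZMod p)ˣ → Matrix (Fin n) (Fin n) (ZMod p) := fun x =>
    diagonal (Function.update (1 : Fin n → ZMod p) z (x.2 : ZMod p)) * (x.1 : Matrix (Fin n) (Fin n) (ZMod p))
  have hdet : ∀ c : ZMod p, (diagonal (Function.update (1 : Fin n → ZMod p) z c)).det = c := by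
    intro c
    rw [det_diagonal, Finset.prod_update_of_mem (Finset.mem_univ z)]
    simp
  have hF : Function.Injective F := by
    rintro ⟨A, c⟩ ⟨B, d⟩ h
    have h1 := congrArg Matrix.det h
    simp only [F, Matrix.det_mul, hdet, Matrix.SpecialLinearGroup.det_coe, mul_one] at h1
    have hcd : c = d := Units.ext h1
    subst hcd
    have hu : IsUnit (diagonal (Function.update (1 : Fin n → ZMod p) z (c : ZMod p))) := by
      rw [Matrix.isUnit_iff_isUnit_det, hdet]; exact c.isUnit
    have h2 := hu.mul_left_cancel h
    exact Prod.ext (Subtype.ext h2) rfl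
  have := Nat.card_le_card_of_injective F hF
  rw [Nat.card_prod, Nat.card_eq_fintype_card (α := (ZMod p)ˣ), ZMod.card_units_eq_totient,
    Nat.totient_prime hp] at this
  refine this.trans (le_of_eq ?_)
  rw [Matrix, Nat.card_fun, Nat.card_fun]
  simp [← pow_mul]

lemma eq_top_of_index_lt (n p : ℕ) [Fact p.Prime] (G : Subgroup (SL n (ZMod p))) (hG : G.index < p) :
    G = ⊤ := by
  have hp := (Fact.out : p.Prime)
  have hG0 : G.index ≠ 0 := Subgroup.index_ne_zero_of_finite
  have htr : ∀ (i j : Fin n) (hij : i ≠ j) (c : ZMod p),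
      Matrix.SpecialLinearGroup.transvection hij c ∈ G := by
    intro i j hij c
    have hpow : ∀ m : ℕ, (Matrix.SpecialLinearGroup.transvection hij c) ^ m
        = Matrix.SpecialLinearGroup.transvection hij ((m : ZMod p) * c) := by
      intro m
      induction m with
      | zero => simp
      | succ m ih =>
        rw [pow_succ, ih, ← Matrix.SpecialLinearGroup.transvection_add]
        congr 1; push_cast; ring
    obtain ⟨m, hm0, hm1, hm2⟩ := Subgroup.exists_pow_mem_of_index_ne_zero hG0
      (Matrix.SpecialLinearGroup.transvection hij c)
    have hm0 : ((m : ℕ) : ZMod p) ≠ 0 := by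
      intro h
      rw [ZMod.natCast_eq_zero_iff] at h
      exact absurd (Nat.le_of_dvd (by omega) h) (by omega)
    have h3 := G.pow_mem hm2 ((m : ZMod p)⁻¹).val
    rw [← pow_mul, hpow] at h3
    push_cast at h3
    rwa [ZMod.natCast_zmod_val, mul_inv_cancel₀ hm0, one_mul] at h3
  rw [eq_top_iff]
  rintro ⟨M, hM⟩ _
  have key : ∃ g ∈ G, (g : Matrix (Fin n) (Fin n) (ZMod p)) = M := by
    apply sl_transvec_induction (fun M => ∃ g ∈ G, (g : Matrix (Fin n) (Fin n) (ZMod p)) = M) _ _ _ M hM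
    · exact ⟨1, G.one_mem, by simp⟩
    · intro i j c hij
      exact ⟨_, htr i j hij c, rfl⟩
    · rintro A B ⟨g, hg, rfl⟩ ⟨g', hg', rfl⟩
      exact ⟨g * g', G.mul_mem hg hg', by simp⟩
  obtain ⟨g, hg, hgM⟩ := key
  have : g = ⟨M, hM⟩ := Subtype.ext hgM
  rwa [← this]

lemma irr_of_span {k : Type*} [Field k] {n : ℕ} (S : Set (Matrix (Fin n) (Fin n) k))
    (hS : Submodule.span k S = ⊤) (W : Submodule k (Fin n → k))
    (hW : ∀ M ∈ S, ∀ w ∈ W, M *ᵥ w ∈ W) : W = ⊥ ∨ W = ⊤ := by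
  have hall : ∀ M : Matrix (Fin n) (Fin n) k, ∀ w ∈ W, M *ᵥ w ∈ W := by
    intro M w hw
    have hM : M ∈ Submodule.span k S := by rw [hS]; trivial
    induction hM using Submodule.span_induction with
    | mem x hx => exact hW x hx w hw
    | zero => simp
    | add x y _ _ hx hy => rw [Matrix.add_mulVec]; exact W.add_mem hx hy
    | smul a x _ hx => rw [Matrix.smul_mulVec]; exact W.smul_mem _ hx
  by_cases h : W = ⊥
  · left; exact h
  · right
    obtain ⟨w, hw, hw0⟩ := Submodule.exists_mem_ne_zero_of_ne_bot h
    obtain ⟨i, hi⟩ := Function.ne_iff.mp hw0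
    rw [eq_top_iff]
    intro v _
    have := hall (Matrix.vecMulVec v (Pi.single i (w i)⁻¹)) w hw
    rw [Matrix.vecMulVec_mulVec] at this
    have h1 : (Pi.single i (w i)⁻¹ : Fin n → k) ⬝ᵥ w = 1 := by
      rw [single_dotProduct]; exact inv_mul_cancel₀ hi
    rw [h1] at this
    simpa using this

lemma index_bound (n p I g s : ℕ) (hn : 0 < n) (hp : 2 ≤ p) (hI : g * I = s) (hg0 : 0 < g)
    (hs : s * (p - 1) ≤ p ^ (n * n))
    (hg : ((p - 1) / (n * n * n) + 1) ^ (n * n - 1) ≤ g) :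
    I ≤ 2 * (n * n * n) ^ (n * n - 1) := by
  set N := n * n - 1 with hN
  have hNN : n * n = N + 1 := by
    have : 0 < n * n := Nat.mul_pos hn hn
    omega
  set q := n * n * n with hq
  have hq0 : 0 < q := by positivity
  have h1 : p ≤ ((p - 1) / q + 1) * q := by
    have := Nat.lt_div_mul_add (a := p - 1) hq0
    rw [add_mul, one_mul]; omega
  have h2 : p ^ N ≤ g * q ^ N := by
    calc p ^ N ≤ (((p - 1) / q + 1) * q) ^ N := Nat.pow_le_pow_left h1 N
      _ = ((p - 1) / q + 1) ^ N * q ^ N := mul_pow _ _ _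
      _ ≤ g * q ^ N := Nat.mul_le_mul_right _ hg
  have h3 : s * (p - 1) ≤ (2 * p ^ N) * (p - 1) := by
    refine hs.trans ?_
    rw [hNN, pow_succ]
    have : p ≤ 2 * (p - 1) := by omega
    calc p ^ N * p ≤ p ^ N * (2 * (p - 1)) := Nat.mul_le_mul_left _ this
      _ = _ := by ring
  have h4 : s ≤ 2 * p ^ N := Nat.le_of_mul_le_mul_right h3 (by omega)
  have h5 : g * I ≤ g * (2 * q ^ N) := by
    rw [hI]
    calc s ≤ 2 * p ^ N := h4
      _ ≤ 2 * (g * q ^ N) := Nat.mul_le_mul_left _ h2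
      _ = _ := by ring
  exact Nat.le_of_mul_le_mul_left h5 hg0

lemma main_step (n : ℕ) (hn : n.Prime) (H : Subgroup (SL n ℤ)) (h : SL n ℤ) (hh : h ∈ H)
    (p : ℕ) [Fact p.Prime] (hp1 : 2 * n ≤ p) (hp2 : 2 * (n * n * n) ^ (n * n - 1) < p)
    (k : Type) [Field k] [CharP k p] [Infinite k]
    (hspan : Submodule.span k ((fun M : Matrix (Fin n) (Fin n) ℤ => M.map ((↑) : ℤ → k)) ''
      ((fun g : SL n ℤ => (g : Matrix (Fin n) (Fin n) ℤ)) '' (H : Set (SL n ℤ)))) = ⊤)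
    (μ : Fin n → k)
    (hchar : (h : Matrix (Fin n) (Fin n) ℤ).charpoly.map (Int.castRingHom k) = ∏ i, (X - C (μ i)))
    (hμ : ∀ i j l m, i ≠ j → μ i * μ m = μ j * μ l → i = l ∧ j = m)
    (hdvd : p ∣ Nat.card (H.map (redMod n p))) : H.map (redMod n p) = ⊤ := by
  have hp := (Fact.out : p.Prime)
  set G := H.map (redMod n p) with hG
  let φ : ZMod p →+* k := ZMod.castHom (dvd_refl p) k
  let ι : SL n (ZMod p) →* (Matrix (Fin n) (Fin n) k)ˣ :=
    Matrix.SpecialLinearGroup.toGL.comp (Matrix.SpecialLinearGroup.map φ)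
  have hιv : ∀ g : SL n (ZMod p), ((ι g : (Matrix (Fin n) (Fin n) k)ˣ) : Matrix (Fin n) (Fin n) k)
      = (g : Matrix (Fin n) (Fin n) (ZMod p)).map φ := fun g => rfl
  have hι : Function.Injective ι := by
    intro a b hab
    have h1 := congrArg (fun u : (Matrix (Fin n) (Fin n) k)ˣ => (u : Matrix (Fin n) (Fin n) k)) hab
    simp only [hιv] at h1
    apply Subtype.ext
    ext i j
    exact φ.injective (congrFun (congrFun h1 i) j)
  have hιr : ∀ g : SL n ℤ, ((ι (redMod n p g) : (Matrix (Fin n) (Fin n) k)ˣ) : Matrix (Fin n) (Fin n) k)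
      = (g : Matrix (Fin n) (Fin n) ℤ).map ((↑) : ℤ → k) := by
    intro g
    rw [hιv]
    ext i j
    simp [redMod]
  set 𝒢 := G.map ι with h𝒢
  have hmem : ∀ g ∈ H, ι (redMod n p g) ∈ 𝒢 := fun g hg => ⟨_, ⟨g, hg, rfl⟩, rfl⟩
  have hcard : Nat.card 𝒢 = Nat.card G :=
    (Nat.card_congr (G.equivMapOfInjective ι hι).toEquiv).symm
  have : Finite 𝒢 := Finite.of_equiv G (G.equivMapOfInjective ι hι).toEquiv
  have hirr : ∀ W : Submodule k (Fin n → k),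
      (∀ g ∈ 𝒢, ∀ w ∈ W, (g : Matrix (Fin n) (Fin n) k) *ᵥ w ∈ W) → W = ⊥ ∨ W = ⊤ := by
    intro W hW
    apply irr_of_span _ hspan W
    rintro _ ⟨_, ⟨g, hg, rfl⟩, rfl⟩ w hw
    have := hW _ (hmem g hg) w hw
    rwa [hιr] at this
  obtain ⟨x, hx⟩ := exists_prime_orderOf_dvd_card' p hdvd
  have hxp : (x : SL n (ZMod p)) ^ p = 1 := by
    have h1 : x ^ p = 1 := orderOf_dvd_iff_pow_eq_one.mp (dvd_of_eq hx)
    exact congrArg Subtype.val h1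
  have hx1 : (x : SL n (ZMod p)) ≠ 1 := by
    intro h1
    rw [← Subgroup.orderOf_coe, h1, orderOf_one] at hx
    exact hp.one_lt.ne hx
  have hE := LieG_full hn p hp1 𝒢 hirr μ hμ (ι (redMod n p h)) (hmem h hh) (by
      rw [← hchar, hιr]
      exact Matrix.charpoly_map _ (Int.castRingHom k)) (ι x) ⟨x, x.2, rfl⟩ (by rw [← map_pow, hxp, map_one])
      (by intro h1; exact hx1 (hι (by rw [h1, map_one])))
  have hcb := card_bound hn.pos p (by omega) ((p - 1) / (n * n * n)) (by
    have := Nat.div_mul_le_self (p - 1) (n * n * n)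
    have h2 := hp.two_le
    calc n * n * ((p - 1) / (n * n * n)) * n = (p - 1) / (n * n * n) * (n * n * n) := by ring
      _ ≤ p - 1 := this
      _ < p := by omega) 𝒢 hE
  rw [hcard] at hcb
  apply eq_top_of_index_lt
  refine lt_of_le_of_lt ?_ hp2
  exact index_bound n p G.index (Nat.card G) (Nat.card (SL n (ZMod p))) hn.pos hp.two_le
    (Subgroup.card_mul_index G) Nat.card_pos (sl_card n p hn.pos) hcb
end Final

/-- For odd prime `n`, if a finitely generated `H ≤ SL(n,ℤ)` contains an
element with irreducible characteristic polynomial and is not solvable-by-finite, then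
`φ_p(H) = SL(n,ℤ/pℤ)` for all but finitely many primes `p`. -/
theorem dense_of_irreducible_element (n : ℕ) (hn : n.Prime) (hodd : Odd n)
    (H : Subgroup (SL n ℤ)) (hFG : H.FG)
    (hel : ∃ h ∈ H, Irreducible (matQ h).charpoly)
    (hsbf : ¬ SolvableByFinite H) :
    {p : ℕ | p.Prime ∧ H.map (redMod n p) ≠ ⊤}.Finite := by
  have hnc : ∃ a ∈ H, ∃ b ∈ H, a * b ≠ b * a := by
    by_contra hcon
    push Not at hcon
    apply hsbf
    refine ⟨⊤, ?_, inferInstance⟩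
    apply isSolvable_of_comm
    rintro ⟨⟨a, ha⟩, _⟩ ⟨⟨b, hb⟩, _⟩
    apply Subtype.ext
    apply Subtype.ext
    exact hcon a ha b hb
  obtain ⟨d1, hd1, hspan⟩ := span_int n hn H hel hnc
  obtain ⟨h, hh, hirr⟩ := hel
  set f := (h : Matrix (Fin n) (Fin n) ℤ).charpoly with hf
  have hfQ : f.map (Int.castRingHom ℚ) = (matQ h).charpoly :=
    (Matrix.charpoly_map _ (Int.castRingHom ℚ)).symm
  obtain ⟨d2, hd2, hroots⟩ := roots_mod n hn hodd f (by rw [hfQ]; exact hirr)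
    (Matrix.charpoly_monic _) (by rw [hf, Matrix.charpoly_natDegree_eq_dim, Fintype.card_fin]) (by
      have := Matrix.det_eq_sign_charpoly_coeff (h : Matrix (Fin n) (Fin n) ℤ)
      rw [Matrix.SpecialLinearGroup.det_coe, Fintype.card_fin, hodd.neg_one_pow] at this
      rw [hf]; linarith)
  have hB := caseB_finite n H hFG hsbf
  set C0 := 2 * n + 2 * (n * n * n) ^ (n * n - 1) with hC0
  refine Set.Finite.subset (((Set.finite_Iic C0).union
    ((Set.finite_Iic d1.natAbs).union (Set.finite_Iic d2.natAbs))).union hB) ?_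
  rintro p ⟨hp, hne⟩
  by_contra hcon
  simp only [Set.mem_union, Set.mem_Iic, Set.mem_setOf_eq, not_or, not_le, not_and, not_not] at hcon
  obtain ⟨⟨hpC, hp1, hp2⟩, hpd⟩ := hcon
  have hdv : ∀ d : ℤ, d ≠ 0 → d.natAbs < p → ¬ (p : ℤ) ∣ d := by
    intro d hd0 hlt hdvd
    have := Int.natAbs_dvd_natAbs.mpr hdvd
    rw [Int.natAbs_natCast] at this
    exact absurd (Nat.le_of_dvd (Int.natAbs_pos.mpr hd0) this) (by omega)
  have : Fact p.Prime := ⟨hp⟩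
  obtain ⟨k, hk1, hk2, μ, hμ1, hμ2⟩ := hroots p hp (hdv d2 hd2 hp2)
  let K := AlgebraicClosure k
  have : CharP K p := charP_of_injective_algebraMap (algebraMap k K).injective p
  have : Infinite K := IsAlgClosed.instInfinite
  apply hne
  refine main_step n hn H h hh p (by omega) (by omega) K ?_ (fun i => algebraMap k K (μ i)) ?_ ?_ (hpd hp)
  · apply span_mod n d1 _ hspan
    intro h0
    exact hdv d1 hd1 hp1 ((CharP.intCast_eq_zero_iff K p d1).mp h0)
  · have := congrArg (Polynomial.map (algebraMap k K)) hμ1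
    rw [Polynomial.map_map, Polynomial.map_prod] at this
    rw [← hf]
    rw [show (Int.castRingHom K) = (algebraMap k K).comp (Int.castRingHom k) from
      RingHom.ext_int _ _, this]
    simp
  · intro i j l m hij h1
    apply hμ2 i j l m hij
    apply (algebraMap k K).injective
    simpa using h1
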